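/- Let m ∈ (1,2]. Then: (i) 𝓛(m) ≤ g_{σ(1 0̄)}(m) for every σ ∈ {L,M,R}*M with m ≥ μ_{σ(1 0̄)}; (ii) 𝓛(m) ≤ f_{σ(0 1̄)}(m) for every σ ∈ {L,M,R}*M with m ≤ μ_{σ(0 1̄)}; (iii) 𝓛(m) ≤ g_{0 1̄}(m) if m ≥ μ_{0 1̄}; (iv) for every u ∈ S_{L,M,R}, 𝓛(m) ≤ g_u(m) if m ≥ μ_u and 𝓛(m) ≤ f_u(m) if m ≤ μ_u. Moreover, whenever β is strictly larger than the respective bound, the Hausdorff dimension of π_β(U_β(m)) is positive. -/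

import Mathlib

/-- `π_β(u)` for a binary sequence `u = u₁u₂⋯` (indexed from 0). -/
noncomputable def piB (β : ℝ) (u : ℕ → Bool) : ℝ :=
  ∑' k : ℕ, (if u k then (1 : ℝ) else 0) / β ^ (k + 1)

/-- `π_β(u)` for a real digit sequence. -/
noncomputable def piR (β : ℝ) (u : ℕ → ℝ) : ℝ := ∑' k : ℕ, u k / β ^ (k + 1)

/-- A binary sequence viewed as a real digit sequence. -/
def bR (u : ℕ → Bool) : ℕ → ℝ := fun k => if u k then 1 else 0

/-- `U_β(A)`: sequences with digits in `A` whose `π_β`-value has no other expansion over `A`. -/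
def Uset (β : ℝ) (A : Set ℝ) : Set (ℕ → ℝ) :=
  {u | (∀ k, u k ∈ A) ∧ ∀ v : ℕ → ℝ, (∀ k, v k ∈ A) → v ≠ u → piR β v ≠ piR β u}

/-- `𝓛(m) = inf {β > 1 : U_β(m) ∩ {0,1}^ℕ is uncountable}`. -/
noncomputable def Lval (m : ℝ) : ℝ :=
  sInf {β : ℝ | 1 < β ∧ ¬ (Uset β {0, 1, m} ∩ {v | ∃ u : ℕ → Bool, v = bR u}).Countable}

/-- The shift orbit `O(u)` of an infinite binary word. -/
def orbit (u : ℕ → Bool) : Set (ℕ → Bool) := {v | ∃ k : ℕ, v = fun i => u (i + k)}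

/-- Suffixes of `u` preceded by the letter `1`. -/
def orbit1 (u : ℕ → Bool) : Set (ℕ → Bool) :=
  {v | ∃ k : ℕ, u k = true ∧ v = fun i => u (i + k + 1)}

/-- Suffixes of `u` preceded by the letter `0`. -/
def orbit0 (u : ℕ → Bool) : Set (ℕ → Bool) :=
  {v | ∃ k : ℕ, u k = false ∧ v = fun i => u (i + k + 1)}

open Classical in
/-- The lexicographic supremum of a set of binary sequences (greedy construction);
`⊥ = 0̄` for the empty set. -/
noncomputable def lexSupSeq (S : Set (ℕ → Bool)) : ℕ → Bool
  | n => decide (∃ u ∈ S, (∀ i, i < n → u i = lexSupSeq S i) ∧ u n = true)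
  termination_by n => n

open Classical in
/-- The lexicographic infimum of a set of binary sequences (greedy construction);
`⊤ = 1̄` for the empty set. -/
noncomputable def lexInfSeq (S : Set (ℕ → Bool)) : ℕ → Bool
  | n => decide (¬ ∃ u ∈ S, (∀ i, i < n → u i = lexInfSeq S i) ∧ u n = false)
  termination_by n => n

/-- `sup O(u)`, the lexicographically largest limit of suffixes of `u`. -/
noncomputable def supO (u : ℕ → Bool) : ℕ → Bool := lexSupSeq (orbit u)
/-- `inf O(u)`. -/
noncomputable def infO (u : ℕ → Bool) : ℕ → Bool := lexInfSeq (orbit u)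
/-- `sup₀(u)`, the supremum of the suffixes preceded by `0`. -/
noncomputable def sup0 (u : ℕ → Bool) : ℕ → Bool := lexSupSeq (orbit0 u)
/-- `inf₁(u)`, the infimum of the suffixes preceded by `1`. -/
noncomputable def inf1 (u : ℕ → Bool) : ℕ → Bool := lexInfSeq (orbit1 u)

/-- Strict lexicographic order on infinite binary words. -/
def lexLt (u v : ℕ → Bool) : Prop := ∃ n, (∀ i, i < n → u i = v i) ∧ u n < v n
/-- Lexicographic order on infinite binary words. -/
def lexLe (u v : ℕ → Bool) : Prop := lexLt u v ∨ u = v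

/-- `f_u(m)`: the unique `β ≥ 1` with `β·π_β(sup O(u)) = m`. -/
noncomputable def fVal (u : ℕ → Bool) (m : ℝ) : ℝ :=
  sInf {β : ℝ | 1 ≤ β ∧ β * piB β (supO u) = m}

/-- `g_u(m)`: the unique `β > 1` with `(β-1)(1+π_β(inf O(u))) = m`. -/
noncomputable def gVal (u : ℕ → Bool) (m : ℝ) : ℝ :=
  sInf {β : ℝ | 1 < β ∧ (β - 1) * (1 + piB β (infO u)) = m}

/-- `μ_u`: the unique `m ∈ (1,2]` with `f_u(m) = g_u(m)`. -/
noncomputable def muVal (u : ℕ → Bool) : ℝ :=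
  sInf {m : ℝ | 1 < m ∧ m ≤ 2 ∧ fVal u m = gVal u m}

/-- `u` contains at least two ones. -/
def TwoOnes (u : ℕ → Bool) : Prop := ∃ k l, k < l ∧ u k = true ∧ u l = true

/-- The substitution `L : 0 ↦ 0, 1 ↦ 01` (with `0 = false`, `1 = true`). -/
def Lsub : Bool → List Bool := fun b => if b then [false, true] else [false]
/-- The substitution `M : 0 ↦ 01, 1 ↦ 10`. -/
def Msub : Bool → List Bool := fun b => if b then [true, false] else [false, true]
/-- The substitution `R : 0 ↦ 01, 1 ↦ 1`. -/
def Rsub : Bool → List Bool := fun b => if b then [true] else [false, true]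
/-- The identity substitution. -/
def idSub : Bool → List Bool := fun b => [b]
/-- Composition of substitutions: `compSub σ τ = σ ∘ τ` (apply `τ` first). -/
def compSub (σ τ : Bool → List Bool) : Bool → List Bool := fun b => (τ b).flatMap σ

/-- The monoid `{L,M,R}*` generated by the three substitutions. -/
def LMRstar : Set (Bool → List Bool) :=
  {σ | ∃ l : List (Bool → List Bool),
    (∀ τ ∈ l, τ = Lsub ∨ τ = Msub ∨ τ = Rsub) ∧ σ = l.foldr compSub idSub}

/-- A substitution applied to an infinite word, `σ(u₁)σ(u₂)⋯`. -/
noncomputable def substApply (σ : Bool → List Bool) (u : ℕ → Bool) : ℕ → Bool := fun n =>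
  let k := sSup {k : ℕ | (∑ i ∈ Finset.range k, (σ (u i)).length) ≤ n}
  (σ (u k)).getD (n - ∑ i ∈ Finset.range k, (σ (u i)).length) false

/-- `u` is a limit word of the sequence of substitutions `σseq`. -/
def IsLimitWord (σseq : ℕ → Bool → List Bool) (u : ℕ → Bool) : Prop :=
  ∃ useq : ℕ → ℕ → Bool, useq 0 = u ∧ ∀ n, useq n = substApply (σseq n) (useq (n + 1))

/-- Primitivity of a sequence of substitutions in `{L,M,R}^ℕ`: no tail is constantly `L`
and no tail is constantly `R`. -/
def PrimitiveSeq (σseq : ℕ → Bool → List Bool) : Prop :=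
  (¬ ∃ k, ∀ n, k ≤ n → σseq n = Lsub) ∧ ¬ ∃ k, ∀ n, k ≤ n → σseq n = Rsub

/-- `S_{L,M,R}`: the set of limit words of primitive sequences of substitutions. -/
def Sset : Set (ℕ → Bool) :=
  {u | ∃ σseq : ℕ → Bool → List Bool,
    (∀ n, σseq n = Lsub ∨ σseq n = Msub ∨ σseq n = Rsub) ∧
    PrimitiveSeq σseq ∧ IsLimitWord σseq u}

/-- The word `1 0̄ = 1000⋯`. -/
def w10bar : ℕ → Bool := fun n => decide (n = 0)
/-- The word `0 1̄ = 0111⋯`. -/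
def w01bar : ℕ → Bool := fun n => decide (n ≠ 0)
/-- The word `01 0̄ = 01000⋯`. -/
def w010bar : ℕ → Bool := fun n => decide (n = 1)
/-- The word `10 1̄ = 10111⋯`. -/
def w101bar : ℕ → Bool := fun n => decide (n ≠ 1)
/-- The word `0̄`. -/
def w0bar : ℕ → Bool := fun _ => false
/-- The word `1̄`. -/
def w1bar : ℕ → Bool := fun _ => true

/-- Prepend a letter to an infinite word. -/
def consB (b : Bool) (u : ℕ → Bool) : ℕ → Bool := fun n =>
  match n with
  | 0 => b
  | Nat.succ k => u k

/-- Prepend a finite word to an infinite word. -/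
def appendW (w : List Bool) (v : ℕ → Bool) : ℕ → Bool := fun n =>
  if n < w.length then w.getD n false else v (n - w.length)

namespace TernaryBases

/-! ### Infinite binary words -/

/-- The word `u` without its first letter. -/
def tl (u : ℕ → Bool) : ℕ → Bool := fun i => u (i + 1)

/-- `v` is a suffix of `x`. -/
def IsSuf (v x : ℕ → Bool) : Prop := ∃ k : ℕ, v = fun i => x (i + k)

lemma tl_consB (b : Bool) (u : ℕ → Bool) : tl (consB b u) = u := rfl

lemma consB_zero (b : Bool) (u : ℕ → Bool) : consB b u 0 = b := rfl

lemma consB_succ (b : Bool) (u : ℕ → Bool) (n : ℕ) : consB b u (n + 1) = u n := rfl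

lemma consB_tl (u : ℕ → Bool) : consB (u 0) (tl u) = u := by
  funext n; cases n <;> rfl

lemma eq_consB_of {u : ℕ → Bool} {b : Bool} (h : u 0 = b) : u = consB b (tl u) := by
  rw [← h, consB_tl]

lemma IsSuf.refl (x : ℕ → Bool) : IsSuf x x := ⟨0, rfl⟩

lemma IsSuf.tl {v x : ℕ → Bool} (h : IsSuf v x) : IsSuf (tl v) x := by
  obtain ⟨k, rfl⟩ := h
  exact ⟨k + 1, by funext i; simp only [TernaryBases.tl]; congr 1; omega⟩

lemma IsSuf.trans {v w x : ℕ → Bool} (h : IsSuf v w) (h' : IsSuf w x) : IsSuf v x := by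
  obtain ⟨k, rfl⟩ := h
  obtain ⟨l, rfl⟩ := h'
  exact ⟨k + l, by funext i; simp only []; congr 1; omega⟩

lemma isSuf_induction {x : ℕ → Bool} {P : (ℕ → Bool) → Prop} (h0 : P x)
    (hs : ∀ v, IsSuf v x → P v → P (tl v)) : ∀ v, IsSuf v x → P v := by
  rintro v ⟨k, rfl⟩
  induction k with
  | zero => exact h0
  | succ k ih =>
    have := hs _ ⟨k, rfl⟩ ih
    convert this using 1
    funext i; simp only [tl]; congr 1; omega

lemma IsSuf.tl_of_consB {v x : ℕ → Bool} {b : Bool} (h : IsSuf v x) : IsSuf v (consB b x) := by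
  obtain ⟨k, rfl⟩ := h
  exact ⟨k + 1, rfl⟩

lemma appendW_nil (v : ℕ → Bool) : appendW [] v = v := by
  funext n; simp [appendW]

lemma appendW_cons (b : Bool) (w : List Bool) (v : ℕ → Bool) :
    appendW (b :: w) v = consB b (appendW w v) := by
  funext n
  cases n with
  | zero => simp [appendW, consB]
  | succ n => simp [appendW, consB]

lemma appendW_append (w w' : List Bool) (v : ℕ → Bool) :
    appendW (w ++ w') v = appendW w (appendW w' v) := by
  induction w with
  | nil => rw [List.nil_append, appendW_nil]
  | cons b w ih => rw [List.cons_append, appendW_cons, appendW_cons, ih]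

/-! ### Substitutions acting on infinite words -/

/-- The length of the image of the first `k` letters of `u`. -/
def prefLen (σ : Bool → List Bool) (u : ℕ → Bool) (k : ℕ) : ℕ :=
  ∑ i ∈ Finset.range k, (σ (u i)).length

lemma prefLen_strictMono {σ : Bool → List Bool} (hσ : ∀ b, σ b ≠ []) (u : ℕ → Bool) :
    StrictMono (prefLen σ u) := by
  refine strictMono_nat_of_lt_succ fun n => ?_
  simp only [prefLen, Finset.sum_range_succ]
  have := List.length_pos_iff.mpr (hσ (u n))
  omega

lemma substApply_of_mem {σ : Bool → List Bool} (hσ : ∀ b, σ b ≠ []) {u : ℕ → Bool} {n k : ℕ}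
    (h1 : prefLen σ u k ≤ n) (h2 : n < prefLen σ u (k + 1)) :
    substApply σ u n = (σ (u k)).getD (n - prefLen σ u k) false := by
  have hk : sSup {k : ℕ | (∑ i ∈ Finset.range k, (σ (u i)).length) ≤ n} = k := by
    apply IsGreatest.csSup_eq
    refine ⟨h1, fun j hj => ?_⟩
    by_contra hlt
    have := (prefLen_strictMono hσ u).monotone (show k + 1 ≤ j by omega)
    have hj' : prefLen σ u j ≤ n := hj
    omega
  unfold substApply
  simp only [hk]
  rfl

lemma exists_prefLen {σ : Bool → List Bool} (hσ : ∀ b, σ b ≠ []) (u : ℕ → Bool) (n : ℕ) :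
    ∃ k, prefLen σ u k ≤ n ∧ n < prefLen σ u (k + 1) := by
  classical
  have hex : ∃ k, n < prefLen σ u k :=
    ⟨n + 1, lt_of_lt_of_le (Nat.lt_succ_self n) ((prefLen_strictMono hσ u).le_apply)⟩
  have hpos : Nat.find hex ≠ 0 := by
    intro h0
    have := Nat.find_spec hex
    rw [h0] at this
    simp [prefLen] at this
  obtain ⟨k, hk⟩ := Nat.exists_eq_succ_of_ne_zero hpos
  refine ⟨k, ?_, ?_⟩
  · exact not_lt.mp (Nat.find_min hex (by omega))
  · have := Nat.find_spec hex
    rwa [hk] at this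

lemma substApply_eq {σ : Bool → List Bool} (hσ : ∀ b, σ b ≠ []) (u : ℕ → Bool) :
    substApply σ u = appendW (σ (u 0)) (substApply σ (tl u)) := by
  funext n
  have hcons : ∀ k, prefLen σ u (k + 1) = prefLen σ (tl u) k + (σ (u 0)).length := fun k =>
    Finset.sum_range_succ' _ _
  have h0 : prefLen σ u 0 = 0 := by simp [prefLen]
  have h0' : prefLen σ (tl u) 0 = 0 := by simp [prefLen]
  by_cases hn : n < (σ (u 0)).length
  · rw [substApply_of_mem hσ (k := 0) (by omega) (by rw [hcons]; omega)]
    simp [appendW, hn, h0]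
  · obtain ⟨k, hk1, hk2⟩ := exists_prefLen hσ (tl u) (n - (σ (u 0)).length)
    rw [substApply_of_mem hσ (k := k + 1) (by rw [hcons]; omega) (by rw [hcons]; omega)]
    simp only [appendW, hn, if_false]
    rw [substApply_of_mem hσ hk1 hk2, hcons]
    congr 1
    omega

lemma eq_of_appendW_eq {A B : (ℕ → Bool) → ℕ → Bool} {σ : Bool → List Bool}
    (hσ : ∀ b, σ b ≠ []) (hA : ∀ u, A u = appendW (σ (u 0)) (A (tl u)))
    (hB : ∀ u, B u = appendW (σ (u 0)) (B (tl u))) (u : ℕ → Bool) : A u = B u := by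
  have key : ∀ n u, A u n = B u n := by
    intro n
    induction n using Nat.strong_induction_on with
    | _ n ih =>
      intro u
      rw [hA, hB]
      simp only [appendW]
      split_ifs with h
      · rfl
      · have := List.length_pos_iff.mpr (hσ (u 0))
        exact ih _ (by omega) _
  exact funext fun n => key n u

lemma substApply_appendW {σ : Bool → List Bool} (hσ : ∀ b, σ b ≠ []) (w : List Bool)
    (v : ℕ → Bool) : substApply σ (appendW w v) = appendW (w.flatMap σ) (substApply σ v) := by
  induction w with
  | nil => simp [appendW_nil]
  | cons b w ih =>
    rw [appendW_cons, substApply_eq hσ, tl_consB, consB_zero, ih, List.flatMap_cons,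
      appendW_append]

lemma compSub_ne_nil {σ τ : Bool → List Bool} (hσ : ∀ b, σ b ≠ []) (hτ : ∀ b, τ b ≠ [])
    (b : Bool) : compSub σ τ b ≠ [] := by
  unfold compSub
  cases h : τ b with
  | nil => exact absurd h (hτ b)
  | cons a l => simp [List.flatMap_cons, hσ a]

lemma substApply_compSub {σ τ : Bool → List Bool} (hσ : ∀ b, σ b ≠ []) (hτ : ∀ b, τ b ≠ [])
    (u : ℕ → Bool) : substApply (compSub σ τ) u = substApply σ (substApply τ u) := by
  refine eq_of_appendW_eq (A := substApply (compSub σ τ))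
    (B := fun u => substApply σ (substApply τ u)) (compSub_ne_nil hσ hτ)
    (substApply_eq (compSub_ne_nil hσ hτ)) (fun u => ?_) u
  rw [substApply_eq hτ u, substApply_appendW hσ]
  rfl

lemma idSub_ne_nil (b : Bool) : idSub b ≠ [] := by simp [idSub]

lemma substApply_idSub (u : ℕ → Bool) : substApply idSub u = u := by
  refine eq_of_appendW_eq (A := substApply idSub) (B := fun u => u) idSub_ne_nil
    (substApply_eq idSub_ne_nil) (fun u => ?_) u
  simp only [idSub]
  rw [appendW_cons, appendW_nil, consB_tl]

/-- `σ` is one of the substitutions `L`, `M`, `R`. -/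
def IsLMR (σ : Bool → List Bool) : Prop := σ = Lsub ∨ σ = Msub ∨ σ = Rsub

lemma IsLMR.ne_nil {σ : Bool → List Bool} (h : IsLMR σ) (b : Bool) : σ b ≠ [] := by
  rcases h with rfl | rfl | rfl <;> cases b <;> simp [Lsub, Msub, Rsub]

/-- Successive application of a list of substitutions to an infinite word, the head last. -/
noncomputable def applyList (l : List (Bool → List Bool)) (x : ℕ → Bool) : ℕ → Bool :=
  l.foldr substApply x

lemma foldr_ne_nil {l : List (Bool → List Bool)} (hl : ∀ τ ∈ l, IsLMR τ) (b : Bool) :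
    l.foldr compSub idSub b ≠ [] := by
  induction l generalizing b with
  | nil => exact idSub_ne_nil b
  | cons τ l ih =>
    exact compSub_ne_nil (hl τ (by simp)).ne_nil
      (fun b => ih (fun τ' h => hl τ' (by simp [h])) b) b

lemma substApply_foldr {l : List (Bool → List Bool)} (hl : ∀ τ ∈ l, IsLMR τ) (u : ℕ → Bool) :
    substApply (l.foldr compSub idSub) u = applyList l u := by
  induction l with
  | nil => exact substApply_idSub u
  | cons τ l ih =>
    have hl' : ∀ τ' ∈ l, IsLMR τ' := fun τ' h => hl τ' (by simp [h])
    rw [List.foldr_cons, substApply_compSub (hl τ (by simp)).ne_nil (foldr_ne_nil hl'), ih hl']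
    rfl

lemma substApply_LMRstar_comp {σ : Bool → List Bool} (hσ : σ ∈ LMRstar) (u : ℕ → Bool) :
    ∃ l : List (Bool → List Bool), (∀ τ ∈ l, IsLMR τ) ∧
      substApply (compSub σ Msub) u = applyList l (substApply Msub u) := by
  obtain ⟨l, hl, rfl⟩ := hσ
  exact ⟨l, hl, by rw [substApply_compSub (foldr_ne_nil hl)
    (IsLMR.ne_nil (Or.inr (Or.inl rfl))), substApply_foldr hl]⟩

/-- The action of `L` on infinite words. -/
noncomputable abbrev opL : (ℕ → Bool) → ℕ → Bool := substApply Lsub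
/-- The action of `M` on infinite words. -/
noncomputable abbrev opM : (ℕ → Bool) → ℕ → Bool := substApply Msub
/-- The action of `R` on infinite words. -/
noncomputable abbrev opR : (ℕ → Bool) → ℕ → Bool := substApply Rsub

lemma opL_consB (b : Bool) (v : ℕ → Bool) :
    opL (consB b v) = consB false (if b then consB true (opL v) else opL v) := by
  rw [opL, substApply_eq (IsLMR.ne_nil (Or.inl rfl))]
  cases b <;> simp [Lsub, appendW_cons, appendW_nil, tl_consB, consB_zero]

lemma opM_consB (b : Bool) (v : ℕ → Bool) :
    opM (consB b v) = consB b (consB (!b) (opM v)) := by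
  rw [opM, substApply_eq (IsLMR.ne_nil (Or.inr (Or.inl rfl)))]
  cases b <;> simp [Msub, appendW_cons, appendW_nil, tl_consB, consB_zero]

lemma opR_consB (b : Bool) (v : ℕ → Bool) :
    opR (consB b v) = if b then consB true (opR v) else consB false (consB true (opR v)) := by
  rw [opR, substApply_eq (IsLMR.ne_nil (Or.inr (Or.inr rfl)))]
  cases b <;> simp [Rsub, appendW_cons, appendW_nil, tl_consB, consB_zero]

lemma opL_false {v : ℕ → Bool} (h : v 0 = false) : opL v = consB false (opL (tl v)) := by
  conv_lhs => rw [eq_consB_of h, opL_consB]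
  simp

lemma opL_true {v : ℕ → Bool} (h : v 0 = true) :
    opL v = consB false (consB true (opL (tl v))) := by
  conv_lhs => rw [eq_consB_of h, opL_consB]
  simp

lemma opM_false {v : ℕ → Bool} (h : v 0 = false) :
    opM v = consB false (consB true (opM (tl v))) := by
  conv_lhs => rw [eq_consB_of h, opM_consB]
  simp

lemma opM_true {v : ℕ → Bool} (h : v 0 = true) :
    opM v = consB true (consB false (opM (tl v))) := by
  conv_lhs => rw [eq_consB_of h, opM_consB]
  simp

lemma opR_false {v : ℕ → Bool} (h : v 0 = false) :
    opR v = consB false (consB true (opR (tl v))) := by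
  conv_lhs => rw [eq_consB_of h, opR_consB]
  simp

lemma opR_true {v : ℕ → Bool} (h : v 0 = true) : opR v = consB true (opR (tl v)) := by
  conv_lhs => rw [eq_consB_of h, opR_consB]
  simp

lemma opL_zero (v : ℕ → Bool) : opL v 0 = false := by
  cases h : v 0
  · rw [opL_false h]; rfl
  · rw [opL_true h]; rfl

lemma opM_zero (v : ℕ → Bool) : opM v 0 = v 0 := by
  cases h : v 0
  · rw [opM_false h]; rfl
  · rw [opM_true h]; rfl

lemma opR_zero (v : ℕ → Bool) : opR v 0 = v 0 := by
  cases h : v 0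
  · rw [opR_false h]; rfl
  · rw [opR_true h]; rfl

lemma isSuf_opL {s x : ℕ → Bool} (h : IsSuf s (opL x)) :
    ∃ v, IsSuf v x ∧ (s = opL v ∨ (v 0 = true ∧ s = consB true (opL (tl v)))) := by
  refine isSuf_induction (P := fun s => ∃ v, IsSuf v x ∧
    (s = opL v ∨ (v 0 = true ∧ s = consB true (opL (tl v))))) ⟨x, .refl x, .inl rfl⟩ ?_ s h
  rintro s - ⟨v, hv, rfl | ⟨h1, rfl⟩⟩
  · cases h0 : v 0
    · exact ⟨tl v, hv.tl, .inl (by rw [opL_false h0, tl_consB])⟩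
    · exact ⟨v, hv, .inr ⟨h0, by rw [opL_true h0, tl_consB]⟩⟩
  · exact ⟨tl v, hv.tl, .inl rfl⟩

lemma isSuf_opM {s x : ℕ → Bool} (h : IsSuf s (opM x)) :
    ∃ v, IsSuf v x ∧ (s = opM v ∨ s = consB (!(v 0)) (opM (tl v))) := by
  refine isSuf_induction (P := fun s => ∃ v, IsSuf v x ∧
    (s = opM v ∨ s = consB (!(v 0)) (opM (tl v)))) ⟨x, .refl x, .inl rfl⟩ ?_ s h
  rintro s - ⟨v, hv, rfl | rfl⟩
  · refine ⟨v, hv, .inr ?_⟩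
    cases h0 : v 0
    · rw [opM_false h0, tl_consB]; rfl
    · rw [opM_true h0, tl_consB]; rfl
  · exact ⟨tl v, hv.tl, .inl rfl⟩

lemma isSuf_opR {s x : ℕ → Bool} (h : IsSuf s (opR x)) :
    ∃ v, IsSuf v x ∧ (s = opR v ∨ (v 0 = false ∧ s = consB true (opR (tl v)))) := by
  refine isSuf_induction (P := fun s => ∃ v, IsSuf v x ∧
    (s = opR v ∨ (v 0 = false ∧ s = consB true (opR (tl v))))) ⟨x, .refl x, .inl rfl⟩ ?_ s h
  rintro s - ⟨v, hv, rfl | ⟨h1, rfl⟩⟩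
  · cases h0 : v 0
    · exact ⟨v, hv, .inr ⟨h0, by rw [opR_false h0, tl_consB]⟩⟩
    · exact ⟨tl v, hv.tl, .inl (by rw [opR_true h0, tl_consB])⟩
  · exact ⟨tl v, hv.tl, .inl rfl⟩

lemma IsSuf.opL {v u : ℕ → Bool} (h : IsSuf v u) : IsSuf (opL v) (opL u) := by
  refine isSuf_induction (P := fun v => IsSuf (TernaryBases.opL v) (TernaryBases.opL u))
    (.refl _) (fun v _ ih => ?_) v h
  cases h0 : v 0
  · rw [opL_false h0] at ih; exact ih.tl
  · rw [opL_true h0] at ih; exact ih.tl.tl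

lemma IsSuf.opM {v u : ℕ → Bool} (h : IsSuf v u) : IsSuf (opM v) (opM u) := by
  refine isSuf_induction (P := fun v => IsSuf (TernaryBases.opM v) (TernaryBases.opM u))
    (.refl _) (fun v _ ih => ?_) v h
  cases h0 : v 0
  · rw [opM_false h0] at ih; exact ih.tl.tl
  · rw [opM_true h0] at ih; exact ih.tl.tl

lemma IsSuf.opR {v u : ℕ → Bool} (h : IsSuf v u) : IsSuf (opR v) (opR u) := by
  refine isSuf_induction (P := fun v => IsSuf (TernaryBases.opR v) (TernaryBases.opR u))
    (.refl _) (fun v _ ih => ?_) v h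
  cases h0 : v 0
  · rw [opR_false h0] at ih; exact ih.tl.tl
  · rw [opR_true h0] at ih; exact ih.tl

/-! ### Lexicographic comparison of prefixes -/

/-- The length `n` prefix of `v` is lexicographically at most that of `w`. -/
def PrefLe (n : ℕ) (v w : ℕ → Bool) : Prop :=
  ∀ j < n, (∀ i < j, v i = w i) → v j ≤ w j

lemma PrefLe.zero (v w : ℕ → Bool) : PrefLe 0 v w := fun _ h => absurd h (Nat.not_lt_zero _)

lemma PrefLe.mono {n k : ℕ} {v w : ℕ → Bool} (h : PrefLe n v w) (hk : k ≤ n) : PrefLe k v w :=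
  fun j hj hij => h j (hj.trans_le hk) hij

lemma PrefLe.trans {n : ℕ} {v w z : ℕ → Bool} (h : PrefLe n v w) (h' : PrefLe n w z) :
    PrefLe n v z := by
  intro j hj hij
  have key : ∀ i < j, v i = w i := by
    intro i
    induction i using Nat.strong_induction_on with
    | _ i ih =>
      intro hi
      have hvw : ∀ l < i, v l = w l := fun l hl => ih l hl (hl.trans hi)
      have h1 := h i (hi.trans hj) hvw
      have h2 := h' i (hi.trans hj) fun l hl => by rw [← hvw l hl, hij l (hl.trans hi)]
      exact le_antisymm h1 (by rw [hij i hi]; exact h2)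
  exact (h j hj key).trans (h' j hj fun i hi => by rw [← key i hi, hij i hi])

lemma prefLe_consB {n : ℕ} {b : Bool} {v w : ℕ → Bool} :
    PrefLe (n + 1) (consB b v) (consB b w) ↔ PrefLe n v w := by
  constructor
  · intro h j hj hij
    refine h (j + 1) (by omega) fun i hi => ?_
    cases i with
    | zero => rfl
    | succ i => exact hij i (by omega)
  · intro h j hj hij
    cases j with
    | zero => exact le_rfl
    | succ j => exact h j (by omega) fun i hi => hij (i + 1) (by omega)

lemma PrefLe.consB {n : ℕ} {v w : ℕ → Bool} (h : PrefLe n v w) (b : Bool) :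
    PrefLe (n + 1) (consB b v) (consB b w) := prefLe_consB.2 h

lemma prefLe_of_lt {n : ℕ} {v w : ℕ → Bool} (hv : v 0 = false) (hw : w 0 = true) :
    PrefLe n v w := by
  intro j _ hij
  cases j with
  | zero => rw [hv, hw]; decide
  | succ j =>
    have := hij 0 (by omega)
    rw [hv, hw] at this
    exact absurd this (by decide)

lemma prefLe_one_of_left {v w : ℕ → Bool} (hv : v 0 = false) : PrefLe 1 v w := by
  intro j hj _
  obtain rfl : j = 0 := by omega
  rw [hv]
  exact Bool.false_le _

lemma prefLe_one_of_right {v w : ℕ → Bool} (hw : w 0 = true) : PrefLe 1 v w := by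
  intro j hj _
  obtain rfl : j = 0 := by omega
  rw [hw]
  exact Bool.le_true _

lemma prefLe_w1bar (n : ℕ) (v : ℕ → Bool) : PrefLe n v w1bar := fun _ _ _ => Bool.le_true _

lemma w0bar_prefLe (n : ℕ) (v : ℕ → Bool) : PrefLe n w0bar v := fun _ _ _ => Bool.false_le _

lemma PrefLe.eq_true {n : ℕ} {v w : ℕ → Bool} (h : PrefLe n v w) (hn : 0 < n)
    (hv : v 0 = true) : w 0 = true := by
  have := h 0 hn (by simp)
  rw [hv] at this
  exact top_le_iff.mp this

lemma PrefLe.eq_false {n : ℕ} {v w : ℕ → Bool} (h : PrefLe n v w) (hn : 0 < n)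
    (hw : w 0 = false) : v 0 = false := by
  have := h 0 hn (by simp)
  rw [hw] at this
  exact le_bot_iff.mp this

lemma PrefLe.tl {n : ℕ} {v w : ℕ → Bool} (h : PrefLe (n + 1) v w) (h0 : v 0 = w 0) :
    PrefLe n (tl v) (tl w) := by
  rw [← consB_tl v, ← consB_tl w, h0] at h
  exact prefLe_consB.1 h

/-- A word starting with `1` is at least as large as its tail. -/
lemma tl_prefLe {n : ℕ} {v : ℕ → Bool} (h : v 0 = true) : PrefLe n (tl v) v := by
  intro j _ hij
  have key : ∀ i ≤ j, v i = true := by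
    intro i
    induction i with
    | zero => exact fun _ => h
    | succ i ih => exact fun hi => (hij i (by omega)).trans (ih (by omega))
  rw [key j le_rfl]
  exact Bool.le_true _

lemma PrefLe.opL {n : ℕ} {v w : ℕ → Bool} (h : PrefLe n v w) :
    PrefLe (n + 1) (opL v) (opL w) := by
  induction n generalizing v w with
  | zero => exact prefLe_one_of_left (opL_zero v)
  | succ n ih =>
    cases hv : v 0 <;> cases hw : w 0
    · rw [opL_false hv, opL_false hw]
      exact (ih (h.tl (hv.trans hw.symm))).consB _
    · rw [opL_false hv, opL_true hw, prefLe_consB]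
      exact prefLe_of_lt (opL_zero _) rfl
    · exact absurd (h.eq_true (Nat.succ_pos n) hv) (by simp [hw])
    · rw [opL_true hv, opL_true hw]
      exact (((ih (h.tl (hv.trans hw.symm))).consB _).consB _).mono (by omega)

lemma PrefLe.opM {n : ℕ} {v w : ℕ → Bool} (h : PrefLe n v w) :
    PrefLe (2 * n) (opM v) (opM w) := by
  induction n generalizing v w with
  | zero => exact PrefLe.zero _ _
  | succ n ih =>
    cases hv : v 0 <;> cases hw : w 0
    · rw [opM_false hv, opM_false hw]
      exact (((ih (h.tl (hv.trans hw.symm))).consB _).consB _)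
    · exact prefLe_of_lt (by rw [opM_zero, hv]) (by rw [opM_zero, hw])
    · exact absurd (h.eq_true (Nat.succ_pos n) hv) (by simp [hw])
    · rw [opM_true hv, opM_true hw]
      exact (((ih (h.tl (hv.trans hw.symm))).consB _).consB _)

lemma PrefLe.opR {n : ℕ} {v w : ℕ → Bool} (h : PrefLe n v w) : PrefLe n (opR v) (opR w) := by
  induction n generalizing v w with
  | zero => exact PrefLe.zero _ _
  | succ n ih =>
    cases hv : v 0 <;> cases hw : w 0
    · rw [opR_false hv, opR_false hw]
      exact (((ih (h.tl (hv.trans hw.symm))).consB _).consB _).mono (by omega)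
    · exact prefLe_of_lt (by rw [opR_zero, hv]) (by rw [opR_zero, hw])
    · exact absurd (h.eq_true (Nat.succ_pos n) hv) (by simp [hw])
    · rw [opR_true hv, opR_true hw]
      exact (ih (h.tl (hv.trans hw.symm))).consB _

lemma PrefLe.opR_false {n : ℕ} {v w : ℕ → Bool} (h : PrefLe (n + 1) v w) (hw : w 0 = false) :
    PrefLe (n + 2) (TernaryBases.opR v) (TernaryBases.opR w) := by
  have hv := h.eq_false (Nat.succ_pos n) hw
  rw [TernaryBases.opR_false hv, TernaryBases.opR_false hw]
  exact ((h.tl (hv.trans hw.symm)).opR.consB _).consB _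

/-- The word `(10)(10)⋯`. -/
noncomputable def w10per : ℕ → Bool := opM w1bar

/-- The word `(01)(01)⋯`. -/
noncomputable def w01per : ℕ → Bool := opM w0bar

lemma w10per_eq : w10per = consB true (consB false w10per) := opM_true (v := w1bar) rfl

lemma w01per_eq : w01per = consB false (consB true w01per) := opM_false (v := w0bar) rfl

lemma eq_of_consB_consB {a b : Bool} {v w : ℕ → Bool} (hv : v = consB a (consB b v))
    (hw : w = consB a (consB b w)) : v = w := by
  have key : ∀ n, v n = w n := by
    intro n
    induction n using Nat.strong_induction_on with
    | _ n ih =>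
      rw [hv, hw]
      match n with
      | 0 => rfl
      | 1 => rfl
      | n + 2 => exact ih n (by omega)
  exact funext key

lemma consB_true_w01per : consB true w01per = w10per := by
  refine eq_of_consB_consB (a := true) (b := false) ?_ w10per_eq
  conv_lhs => rw [w01per_eq]

lemma consB_false_w10per : consB false w10per = w01per := by
  refine eq_of_consB_consB (a := false) (b := true) ?_ w01per_eq
  conv_lhs => rw [w10per_eq]

lemma opM_prefLe (n : ℕ) (v w : ℕ → Bool) : PrefLe n (opM v) (consB true (opM w)) := by
  refine PrefLe.trans (((prefLe_w1bar n v).opM).mono (by omega)) ?_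
  change PrefLe n w10per _
  rw [← consB_true_w01per]
  exact ((((w0bar_prefLe n w).opM).mono (show n ≤ 2 * n by omega)).consB _).mono (by omega)

lemma prefLe_opM (n : ℕ) (v w : ℕ → Bool) : PrefLe n (consB false (opM w)) (opM v) := by
  refine PrefLe.trans ?_ (((w0bar_prefLe n v).opM).mono (by omega))
  change PrefLe n _ w01per
  rw [← consB_false_w10per]
  exact ((((prefLe_w1bar n w).opM).mono (show n ≤ 2 * n by omega)).consB _).mono (by omega)

/-! ### Approximation of the extremal suffixes -/

/-- `u` contains the factor `10`. -/
def Has10 (u : ℕ → Bool) : Prop := ∃ w, IsSuf w u ∧ w 0 = true ∧ tl w 0 = false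

lemma Has10.opL {u : ℕ → Bool} (h : Has10 u) : Has10 (opL u) := by
  obtain ⟨w, hw, h1, -⟩ := h
  have := hw.opL
  rw [opL_true h1] at this
  exact ⟨_, this.tl, rfl, opL_zero _⟩

lemma has10_opM (u : ℕ → Bool) : Has10 (opM u) := by
  have h := IsSuf.refl (opM u)
  cases h0 : u 0
  · rw [show IsSuf (opM u) (opM u) = IsSuf (consB false (consB true (opM (tl u)))) (opM u) by
      rw [← opM_false h0]] at h
    cases h1 : tl u 0
    · exact ⟨_, h.tl, rfl, by rw [tl_consB, tl_consB, opM_zero, h1]⟩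
    · have h2 := h.tl.tl
      rw [tl_consB, tl_consB, opM_true h1] at h2
      exact ⟨_, h2, rfl, rfl⟩
  · rw [show IsSuf (opM u) (opM u) = IsSuf (consB true (consB false (opM (tl u)))) (opM u) by
      rw [← opM_true h0]] at h
    exact ⟨_, h, rfl, rfl⟩

lemma Has10.opR {u : ℕ → Bool} (h : Has10 u) : Has10 (opR u) := by
  obtain ⟨w, hw, h1, h2⟩ := h
  have := hw.opR
  rw [opR_true h1] at this
  exact ⟨_, this, rfl, by rw [tl_consB, opR_zero, h2]⟩

/-- The suffixes of `x` are bounded, up to prefixes of length about `n`, by suffixes of `u`. -/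
structure Approx (n : ℕ) (x u : ℕ → Bool) : Prop where
  zero : x 0 = false
  upper : ∀ v, IsSuf v x → v 0 = false → ∃ w, IsSuf w u ∧ w 0 = false ∧ PrefLe n (tl v) (tl w)
  lower : ∀ v, IsSuf v x → ∃ w, IsSuf w u ∧ PrefLe (n + 1) w v
  lower_one : ∀ v, IsSuf v x → v 0 = true →
    ∃ w, IsSuf w u ∧ w 0 = true ∧ PrefLe n (tl w) (tl v)
  has10 : Has10 u

lemma Approx.base {x u : ℕ → Bool} (hx : x 0 = false) (hu : Has10 u) : Approx 0 x u := by
  obtain ⟨w, hw, h1, h0⟩ := id hu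
  exact ⟨hx, fun v _ _ => ⟨_, hw.tl, h0, PrefLe.zero _ _⟩,
    fun v _ => ⟨_, hw.tl, prefLe_one_of_left h0⟩, fun v _ _ => ⟨_, hw, h1, PrefLe.zero _ _⟩, hu⟩

lemma Approx.mono {n k : ℕ} {x u : ℕ → Bool} (h : Approx n x u) (hk : k ≤ n) : Approx k x u := by
  refine ⟨h.zero, fun v hv h0 => ?_, fun v hv => ?_, fun v hv h0 => ?_, h.has10⟩
  · obtain ⟨w, hw, h1, h2⟩ := h.upper v hv h0
    exact ⟨w, hw, h1, h2.mono hk⟩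
  · obtain ⟨w, hw, h2⟩ := h.lower v hv
    exact ⟨w, hw, h2.mono (by omega)⟩
  · obtain ⟨w, hw, h1, h2⟩ := h.lower_one v hv h0
    exact ⟨w, hw, h1, h2.mono hk⟩

lemma exists_upper_of_true {n : ℕ} {x u : ℕ → Bool} (hx : x 0 = false)
    (h : ∀ v, IsSuf v x → v 0 = false → ∃ w, IsSuf w u ∧ w 0 = false ∧ PrefLe n (tl v) (tl w)) :
    ∀ v, IsSuf v x → v 0 = true → ∃ w, IsSuf w u ∧ w 0 = false ∧ PrefLe n v (tl w) := by
  refine isSuf_induction (fun h1 => absurd h1 (by simp [hx])) fun v hv ih h1 => ?_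
  cases h0 : v 0
  · exact h v hv h0
  · obtain ⟨w, hw, hw0, hle⟩ := ih h0
    exact ⟨w, hw, hw0, (tl_prefLe h0).trans hle⟩

lemma Approx.exists_upper {n : ℕ} {x u : ℕ → Bool} (h : Approx n x u) {v : ℕ → Bool}
    (hv : IsSuf v x) : ∃ w, IsSuf w u ∧ PrefLe n v w := by
  cases h0 : v 0
  · obtain ⟨w, hw, h1, h2⟩ := h.upper v hv h0
    refine ⟨w, hw, ?_⟩
    rw [eq_consB_of h0, eq_consB_of h1]
    exact (h2.consB _).mono (by omega)
  · obtain ⟨w, hw, -, h2⟩ := exists_upper_of_true h.zero h.upper v hv h0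
    exact ⟨_, hw.tl, h2⟩

lemma Approx.opL {n : ℕ} {x u : ℕ → Bool} (h : Approx n x u) :
    Approx (n + 1) (opL x) (opL u) := by
  refine ⟨opL_zero x, fun s hs s0 => ?_, fun s hs => ?_, fun s hs s0 => ?_, h.has10.opL⟩
  · obtain ⟨v, hv, rfl | ⟨-, rfl⟩⟩ := isSuf_opL hs
    · cases v0 : v 0
      · obtain ⟨w, hw, w0, hle⟩ := h.upper v hv v0
        refine ⟨_, hw.opL, opL_zero w, ?_⟩
        rw [opL_false v0, opL_false w0, tl_consB, tl_consB]
        exact hle.opL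
      · rw [opL_true v0, tl_consB]
        match n, h with
        | 0, h =>
          obtain ⟨w, hw, w0, -⟩ := h.has10
          refine ⟨_, hw.opL, opL_zero w, ?_⟩
          rw [opL_true w0, tl_consB]
          exact prefLe_one_of_right rfl
        | n + 1, h =>
          obtain ⟨w, hw, -, hle⟩ := exists_upper_of_true h.zero h.upper v hv v0
          have z0 := hle.eq_true (Nat.succ_pos n) v0
          refine ⟨_, hw.tl.opL, opL_zero _, ?_⟩
          rw [opL_true z0, tl_consB]
          exact (hle.tl (v0.trans z0.symm)).opL.consB _
    · exact absurd s0 (by simp [consB_zero])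
  · obtain ⟨v, hv, rfl | ⟨-, rfl⟩⟩ := isSuf_opL hs
    · obtain ⟨w, hw, hle⟩ := h.lower v hv
      exact ⟨_, hw.opL, hle.opL⟩
    · exact ⟨_, .refl _, prefLe_of_lt (opL_zero u) rfl⟩
  · obtain ⟨v, hv, rfl | ⟨v0, rfl⟩⟩ := isSuf_opL hs
    · exact absurd s0 (by simp [opL_zero])
    · obtain ⟨w, hw, w0, hle⟩ := h.lower_one v hv v0
      have := hw.opL
      rw [opL_true w0] at this
      exact ⟨_, this.tl, rfl, hle.opL⟩

lemma Approx.opR {n : ℕ} {x u : ℕ → Bool} (h : Approx n x u) :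
    Approx (n + 1) (opR x) (opR u) := by
  have hsmall : ∃ w, IsSuf w (TernaryBases.opR u) ∧ w 0 = false := by
    obtain ⟨w, hw, w0, -⟩ := h.upper x (.refl x) h.zero
    exact ⟨_, hw.opR, by rw [opR_zero, w0]⟩
  refine ⟨by rw [opR_zero, h.zero], fun s hs s0 => ?_, fun s hs => ?_, fun s hs s0 => ?_,
    h.has10.opR⟩
  · obtain ⟨v, hv, rfl | ⟨-, rfl⟩⟩ := isSuf_opR hs
    · rw [opR_zero] at s0
      obtain ⟨w, hw, w0, hle⟩ := h.upper v hv s0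
      refine ⟨_, hw.opR, by rw [opR_zero, w0], ?_⟩
      rw [opR_false s0, opR_false w0, tl_consB, tl_consB]
      exact hle.opR.consB _
    · exact absurd s0 (by simp [consB_zero])
  · obtain ⟨z, hz, z0⟩ := hsmall
    obtain ⟨v, hv, rfl | ⟨-, rfl⟩⟩ := isSuf_opR hs
    · cases v0 : v 0
      · obtain ⟨w, hw, hle⟩ := h.lower v hv
        exact ⟨_, hw.opR, hle.opR_false v0⟩
      · exact ⟨z, hz, prefLe_of_lt z0 (by rw [opR_zero, v0])⟩
    · exact ⟨z, hz, prefLe_of_lt z0 rfl⟩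
  · have key : ∀ y : ℕ → Bool, (y 0 = false → n ≠ 0 →
        ∃ w, IsSuf w u ∧ PrefLe n (tl w) y) →
        ∃ w, IsSuf w (TernaryBases.opR u) ∧ w 0 = true ∧
          PrefLe (n + 1) (tl w) (TernaryBases.opR y) := by
      intro y hy
      obtain ⟨c, hc, c1, c0⟩ := h.has10.opR
      match n, hy with
      | 0, _ => exact ⟨c, hc, c1, prefLe_one_of_left c0⟩
      | n + 1, hy =>
        cases y0 : y 0
        · obtain ⟨w, hw, hle⟩ := hy y0 (Nat.succ_ne_zero n)
          refine ⟨consB true (TernaryBases.opR (tl w)), ?_, rfl, hle.opR_false y0⟩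
          have := hw.opR
          cases w0 : w 0
          · rw [opR_false w0] at this
            exact this.tl
          · rwa [opR_true w0] at this
        · exact ⟨c, hc, c1, prefLe_of_lt c0 (by rw [opR_zero, y0])⟩
    obtain ⟨v, hv, rfl | ⟨v0, rfl⟩⟩ := isSuf_opR hs
    · rw [opR_zero] at s0
      rw [opR_true s0, tl_consB]
      refine key _ fun _ _ => ?_
      obtain ⟨w, hw, -, hle⟩ := h.lower_one v hv s0
      exact ⟨w, hw, hle⟩
    · rw [tl_consB]
      refine key _ fun _ _ => ?_
      obtain ⟨w, hw, hle⟩ := h.lower v hv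
      exact ⟨w, hw, hle.tl ((hle.eq_false (Nat.succ_pos n) v0).trans v0.symm)⟩

lemma Approx.opM {n : ℕ} {x u : ℕ → Bool} (h : Approx n x u) :
    Approx (n + 1) (opM x) (opM u) := by
  obtain ⟨z, hz, z0, -⟩ := h.upper x (.refl x) h.zero
  obtain ⟨c, hc, c1, c0⟩ := h.has10
  refine ⟨by rw [opM_zero, h.zero], fun s hs s0 => ?_, fun s hs => ?_, fun s hs s0 => ?_,
    has10_opM u⟩
  · obtain ⟨v, hv, rfl | rfl⟩ := isSuf_opM hs
    · rw [opM_zero] at s0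
      obtain ⟨w, hw, w0, hle⟩ := h.upper v hv s0
      refine ⟨_, hw.opM, by rw [opM_zero, w0], ?_⟩
      rw [opM_false s0, opM_false w0, tl_consB, tl_consB]
      exact (hle.opM.consB _).mono (by omega)
    · refine ⟨_, hz.opM, by rw [opM_zero, z0], ?_⟩
      rw [opM_false z0, tl_consB, tl_consB]
      exact opM_prefLe _ _ _
  · obtain ⟨v, hv, rfl | rfl⟩ := isSuf_opM hs
    · obtain ⟨w, hw, hle⟩ := h.lower v hv
      exact ⟨_, hw.opM, hle.opM.mono (by omega)⟩
    · cases v0 : v 0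
      · exact ⟨_, hz.opM, prefLe_of_lt (by rw [opM_zero, z0]) rfl⟩
      · match n, h with
        | 0, h =>
          have hc' := hc.opM
          rw [opM_true c1] at hc'
          refine ⟨_, hc'.tl, ?_⟩
          exact (prefLe_one_of_left (by rw [opM_zero, c0])).consB _
        | n + 1, h =>
          obtain ⟨w, hw, w0, hle⟩ := h.lower_one v hv v0
          have hw' := hw.opM
          rw [opM_true w0] at hw'
          exact ⟨_, hw'.tl, (hle.opM.consB _).mono (by omega)⟩
  · obtain ⟨v, hv, rfl | rfl⟩ := isSuf_opM hs
    · rw [opM_zero] at s0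
      obtain ⟨w, hw, w0, hle⟩ := h.lower_one v hv s0
      refine ⟨_, hw.opM, by rw [opM_zero, w0], ?_⟩
      rw [opM_true s0, opM_true w0, tl_consB, tl_consB]
      exact (hle.opM.consB _).mono (by omega)
    · refine ⟨_, hc.opM, by rw [opM_zero, c1], ?_⟩
      rw [opM_true c1, tl_consB, tl_consB]
      exact prefLe_opM _ _ _

lemma Approx.substApply {n : ℕ} {x u : ℕ → Bool} (h : Approx n x u) {σ : Bool → List Bool}
    (hσ : IsLMR σ) : Approx (n + 1) (substApply σ x) (substApply σ u) := by
  rcases hσ with rfl | rfl | rfl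
  exacts [h.opL, h.opM, h.opR]

lemma Approx.applyList {n : ℕ} {x u : ℕ → Bool} (h : Approx n x u)
    {l : List (Bool → List Bool)} (hl : ∀ τ ∈ l, IsLMR τ) :
    Approx (n + l.length) (applyList l x) (applyList l u) := by
  induction l with
  | nil => exact h
  | cons τ l ih =>
    exact (ih fun τ' h => hl τ' (by simp [h])).substApply (hl τ (by simp))

/-- For every `n`, there is a composition of the substitutions all of whose images, of words
starting with `0`, have their suffixes bounded, up to prefixes of length `n`, by suffixes of `u`. -/
def Approximable (u : ℕ → Bool) : Prop :=
  ∀ n, ∃ l : List (Bool → List Bool), (∀ τ ∈ l, IsLMR τ) ∧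
    ∀ y, ∀ v, IsSuf v (applyList l (consB false y)) →
      (∃ w, IsSuf w u ∧ PrefLe n v w) ∧ ∃ w, IsSuf w u ∧ PrefLe n w v

lemma applyList_append (l l' : List (Bool → List Bool)) (x : ℕ → Bool) :
    applyList (l ++ l') x = applyList l (applyList l' x) := by
  simp [applyList, List.foldr_append]

lemma approximable_of_approx {u : ℕ → Bool}
    (h : ∀ n, ∃ l : List (Bool → List Bool), (∀ τ ∈ l, IsLMR τ) ∧
      ∀ y, Approx n (applyList l (consB false y)) u) : Approximable u := by
  intro n
  obtain ⟨l, hl, hA⟩ := h n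
  refine ⟨l, hl, fun y v hv => ⟨(hA y).exists_upper hv, ?_⟩⟩
  obtain ⟨w, hw, hle⟩ := (hA y).lower v hv
  exact ⟨w, hw, hle.mono (Nat.le_succ n)⟩

lemma approximable_applyList {u : ℕ → Bool} {l : List (Bool → List Bool)}
    (hl : ∀ τ ∈ l, IsLMR τ)
    (h : ∀ n, ∃ l : List (Bool → List Bool), (∀ τ ∈ l, IsLMR τ) ∧
      ∀ y, Approx n (applyList l (consB false y)) u) : Approximable (applyList l u) := by
  refine approximable_of_approx fun n => ?_
  obtain ⟨l', hl', hA⟩ := h n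
  refine ⟨l ++ l', fun τ hτ => ?_, fun y => ?_⟩
  · rcases List.mem_append.1 hτ with h | h
    exacts [hl τ h, hl' τ h]
  · rw [applyList_append]
    exact ((hA y).applyList hl).mono (by omega)

lemma isLMR_of_mem_replicate {n : ℕ} {σ : Bool → List Bool} (hσ : IsLMR σ) :
    ∀ τ ∈ List.replicate n σ, IsLMR τ := fun τ hτ => by
  rw [List.eq_of_mem_replicate hτ]; exact hσ

lemma isLMR_L : IsLMR Lsub := .inl rfl
lemma isLMR_R : IsLMR Rsub := .inr (.inr rfl)

lemma w01bar_eq : w01bar = consB false w1bar := by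
  funext n; cases n <;> rfl

lemma w1bar_eq : w1bar = consB true w1bar := by
  funext n; cases n <;> rfl

lemma w10bar_eq : w10bar = consB true w0bar := by
  funext n; cases n <;> rfl

lemma w010bar_eq : w010bar = consB false w10bar := by
  funext n
  match n with
  | 0 => rfl
  | 1 => rfl
  | n + 2 => simp [w010bar, w10bar, consB]

lemma opL_w0bar : opL w0bar = w0bar := by
  have key : ∀ n, opL w0bar n = false := by
    intro n
    induction n with
    | zero => exact opL_zero _
    | succ n ih => rw [opL_false (v := w0bar) rfl]; exact ih
  exact funext key

lemma opR_w1bar : opR w1bar = w1bar := by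
  have key : ∀ n, opR w1bar n = true := by
    intro n
    induction n with
    | zero => exact opR_zero _
    | succ n ih => rw [opR_true (v := w1bar) rfl]; exact ih
  exact funext key

lemma opL_w1bar : opL w1bar = w01per :=
  eq_of_consB_consB (opL_true (v := w1bar) rfl) w01per_eq

lemma opR_w0bar : opR w0bar = w01per :=
  eq_of_consB_consB (opR_false (v := w0bar) rfl) w01per_eq

lemma opM_w10bar : opM w10bar = consB true (opL w01bar) := by
  rw [w10bar_eq, opM_consB, w01bar_eq, opL_consB]
  simp only [Bool.not_true, Bool.false_eq_true, if_false]
  rw [opL_w1bar]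
  rfl

lemma opM_w01bar : opM w01bar = opR w010bar := by
  rw [w01bar_eq, opM_consB, w010bar_eq, w10bar_eq, opR_consB, opR_consB]
  simp only [Bool.not_false, Bool.false_eq_true, if_false, if_true]
  rw [opR_w0bar, consB_true_w01per]
  rfl

/-- Under iteration of `R`, all suffixes are eventually bounded below by `01⋯1`. -/
lemma w01bar_prefLe (n : ℕ) (x : ℕ → Bool) (v : ℕ → Bool)
    (hv : IsSuf v (applyList (List.replicate n Rsub) x)) : PrefLe (n + 1) w01bar v := by
  induction n generalizing v with
  | zero => exact prefLe_one_of_left rfl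
  | succ n ih =>
    obtain ⟨w, hw, rfl | ⟨-, rfl⟩⟩ := isSuf_opR hv
    · cases w0 : w 0
      · have := (ih w hw).opR_false w0
        rw [w01bar_eq, opR_consB, opR_w1bar, ← w1bar_eq] at this
        rw [w01bar_eq]
        simpa using this
      · exact prefLe_of_lt rfl (by rw [opR_zero, w0])
    · exact prefLe_of_lt rfl rfl

lemma approximable_w01bar : Approximable w01bar := by
  refine fun n => ⟨List.replicate n Rsub, isLMR_of_mem_replicate isLMR_R, fun y v hv => ⟨?_, ?_⟩⟩
  · refine ⟨w1bar, ?_, prefLe_w1bar n v⟩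
    rw [w01bar_eq]
    exact (IsSuf.refl _).tl_of_consB
  · exact ⟨w01bar, .refl _, (w01bar_prefLe n _ v hv).mono (Nat.le_succ n)⟩

lemma approx_opM_w10bar (n : ℕ) (y : ℕ → Bool) :
    Approx n (applyList (Lsub :: List.replicate n Rsub) y) (opM w10bar) := by
  change Approx n (opL (applyList (List.replicate n Rsub) y)) _
  have hL : IsSuf (opL w01bar) (opM w10bar) := by
    rw [opM_w10bar]; exact (IsSuf.refl _).tl_of_consB
  have hP : IsSuf w01per (opM w10bar) := by
    rw [w01bar_eq, opL_consB] at hL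
    exact opL_w1bar ▸ hL.tl
  refine ⟨opL_zero _, fun s hs s0 => ⟨w01per, hP, opM_zero _, ?_⟩, fun s hs => ?_,
    fun s hs s0 => ?_, has10_opM _⟩
  · rw [w01per_eq, tl_consB]
    obtain ⟨v, hv, rfl | ⟨-, rfl⟩⟩ := isSuf_opL hs
    · cases v0 : v 0
      · rw [opL_false v0, tl_consB]
        exact prefLe_of_lt (opL_zero _) rfl
      · rw [opL_true v0, tl_consB, ← opL_w1bar]
        exact ((prefLe_w1bar n _).opL.consB _).mono (by omega)
    · exact absurd s0 (by simp [consB_zero])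
  · refine ⟨_, hL, ?_⟩
    obtain ⟨v, hv, rfl | ⟨-, rfl⟩⟩ := isSuf_opL hs
    · exact (w01bar_prefLe n _ v hv).opL.mono (by omega)
    · exact prefLe_of_lt (opL_zero _) rfl
  · refine ⟨_, .refl _, opM_zero _, ?_⟩
    rw [opM_w10bar, tl_consB]
    obtain ⟨v, hv, rfl | ⟨v0, rfl⟩⟩ := isSuf_opL hs
    · exact absurd s0 (by simp [opL_zero])
    · exact (w01bar_prefLe n _ _ hv.tl).opL.mono (by omega)

/-- The word `0⋯010̄` with its only `1` at position `n`. -/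
def w0s10bar (n : ℕ) : ℕ → Bool := fun i => decide (i = n)

lemma applyList_L_w10bar (n : ℕ) :
    applyList (List.replicate n Lsub) w10bar = w0s10bar n := by
  have hshift : ∀ n, w0s10bar (n + 1) = consB false (w0s10bar n) := by
    intro n; funext i; cases i <;> simp [w0s10bar, consB]
  have hL : ∀ n, opL (w0s10bar n) = w0s10bar (n + 1) := by
    intro n
    induction n with
    | zero =>
      change opL w10bar = _
      rw [hshift, w10bar_eq, opL_consB, if_pos rfl, opL_w0bar, ← w10bar_eq]
      rfl
    | succ n ih =>
      rw [hshift, opL_consB, ih]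
      simp [hshift]
  induction n with
  | zero => rfl
  | succ n ih =>
    change opL (applyList (List.replicate n Lsub) w10bar) = _
    rw [ih, hL]

lemma w0s10bar_suf_prefLe {m : ℕ} {z : ℕ → Bool} (hz : IsSuf z (w0s10bar m)) (n : ℕ) :
    PrefLe n z w10bar := by
  obtain ⟨k, rfl⟩ := hz
  intro j _ hij
  match j with
  | 0 => exact Bool.le_true _
  | j + 1 =>
    have := hij 0 (by omega)
    simp only [w0s10bar, w10bar, Nat.zero_add, decide_true, decide_eq_true_eq] at this
    simp [w0s10bar, w10bar, ← this]

lemma approx_w010bar (n : ℕ) (y : ℕ → Bool) :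
    Approx n (applyList (List.replicate n Lsub) (consB false y)) w010bar := by
  have h10 : Has10 w10bar := ⟨_, .refl _, rfl, rfl⟩
  have hs : IsSuf w10bar w010bar := by rw [w010bar_eq]; exact (IsSuf.refl _).tl_of_consB
  have hs0 : IsSuf w0bar w010bar := by rw [w10bar_eq] at hs; exact hs.tl
  have h := ((Approx.base (x := consB false y) rfl h10).applyList
    (isLMR_of_mem_replicate (n := n) isLMR_L))
  rw [applyList_L_w10bar, List.length_replicate, Nat.zero_add] at h
  refine ⟨h.zero, fun v hv v0 => ?_, fun v _ => ⟨_, hs0, w0bar_prefLe _ _⟩, fun v _ _ => ?_,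
    ⟨_, hs, rfl, rfl⟩⟩
  · obtain ⟨w, hw, -, hle⟩ := h.upper v hv v0
    refine ⟨w010bar, .refl _, rfl, hle.trans ?_⟩
    rw [w010bar_eq]
    exact w0s10bar_suf_prefLe hw.tl n
  · exact ⟨_, hs, rfl, by rw [w10bar_eq]; exact w0bar_prefLe _ _⟩

lemma approximable_comp_M_w10bar {σ : Bool → List Bool} (hσ : σ ∈ LMRstar) :
    Approximable (substApply (compSub σ Msub) w10bar) := by
  obtain ⟨l, hl, h⟩ := substApply_LMRstar_comp hσ w10bar
  rw [h]
  refine approximable_applyList hl fun n =>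
    ⟨Lsub :: List.replicate n Rsub, fun τ hτ => ?_, fun y => approx_opM_w10bar n _⟩
  rcases List.mem_cons.1 hτ with rfl | h
  exacts [isLMR_L, isLMR_of_mem_replicate isLMR_R τ h]

lemma approximable_comp_M_w01bar {σ : Bool → List Bool} (hσ : σ ∈ LMRstar) :
    Approximable (substApply (compSub σ Msub) w01bar) := by
  obtain ⟨l, hl, h⟩ := substApply_LMRstar_comp hσ w01bar
  rw [h]
  refine approximable_applyList hl fun n =>
    ⟨Rsub :: List.replicate n Lsub, fun τ hτ => ?_, fun y => ?_⟩
  · rcases List.mem_cons.1 hτ with rfl | h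
    exacts [isLMR_R, isLMR_of_mem_replicate isLMR_L τ h]
  · change Approx n (opR (applyList (List.replicate n Lsub) (consB false y))) (opM w01bar)
    rw [opM_w01bar]
    exact (approx_w010bar n y).opR.mono (Nat.le_succ n)

/-! ### Recurrence of the letter `1` -/

/-- `u` contains infinitely many ones. -/
def InfOnes (u : ℕ → Bool) : Prop := ∀ v, IsSuf v u → ∃ k, v k = true

lemma exists_opL_true {v : ℕ → Bool} {k : ℕ} (h : v k = true) : ∃ j, opL v j = true := by
  induction k generalizing v with
  | zero => exact ⟨1, by rw [opL_true h]; rfl⟩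
  | succ k ih =>
    obtain ⟨j, hj⟩ := ih (v := tl v) h
    cases v0 : v 0
    · exact ⟨j + 1, by rw [opL_false v0]; exact hj⟩
    · exact ⟨1, by rw [opL_true v0]; rfl⟩

lemma InfOnes.opL {u : ℕ → Bool} (h : InfOnes u) : InfOnes (opL u) := by
  intro s hs
  obtain ⟨v, hv, rfl | ⟨-, rfl⟩⟩ := isSuf_opL hs
  · obtain ⟨k, hk⟩ := h v hv
    exact exists_opL_true hk
  · exact ⟨0, rfl⟩

lemma infOnes_opM (u : ℕ → Bool) : InfOnes (opM u) := by
  have key : ∀ v, ∃ k, opM v k = true := by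
    intro v
    cases v0 : v 0
    · exact ⟨1, by rw [opM_false v0]; rfl⟩
    · exact ⟨0, by rw [opM_true v0]; rfl⟩
  intro s hs
  obtain ⟨v, hv, rfl | rfl⟩ := isSuf_opM hs
  · exact key v
  · obtain ⟨k, hk⟩ := key (tl v)
    exact ⟨k + 1, hk⟩

lemma infOnes_opR (u : ℕ → Bool) : InfOnes (opR u) := by
  intro s hs
  obtain ⟨v, hv, rfl | ⟨-, rfl⟩⟩ := isSuf_opR hs
  · cases v0 : v 0
    · exact ⟨1, by rw [opR_false v0]; rfl⟩
    · exact ⟨0, by rw [opR_true v0]; rfl⟩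
  · exact ⟨0, rfl⟩

lemma InfOnes.substApply {u : ℕ → Bool} (h : InfOnes u) {σ : Bool → List Bool}
    (hσ : IsLMR σ) : InfOnes (substApply σ u) := by
  rcases hσ with rfl | rfl | rfl
  exacts [h.opL, infOnes_opM u, infOnes_opR u]

lemma InfOnes.applyList {u : ℕ → Bool} (h : InfOnes u) {l : List (Bool → List Bool)}
    (hl : ∀ τ ∈ l, IsLMR τ) : InfOnes (applyList l u) := by
  induction l with
  | nil => exact h
  | cons τ l ih => exact (ih fun τ' h => hl τ' (by simp [h])).substApply (hl τ (by simp))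

lemma Has10.substApply {u : ℕ → Bool} (h : Has10 u) {σ : Bool → List Bool}
    (hσ : IsLMR σ) : Has10 (substApply σ u) := by
  rcases hσ with rfl | rfl | rfl
  exacts [h.opL, has10_opM u, h.opR]

lemma infOnes_comp_M {σ : Bool → List Bool} (hσ : σ ∈ LMRstar) (w : ℕ → Bool) :
    InfOnes (substApply (compSub σ Msub) w) := by
  obtain ⟨l, hl, h⟩ := substApply_LMRstar_comp hσ w
  rw [h]
  exact (infOnes_opM w).applyList hl

lemma infOnes_w01bar : InfOnes w01bar := by
  rintro v ⟨k, rfl⟩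
  exact ⟨1, by simp [w01bar]⟩

lemma backward_induction {P : ℕ → Prop} (hP : ∀ n, P (n + 1) → P n) {n k : ℕ} (hk : k ≤ n)
    (h : P n) : P k := by
  induction n, hk using Nat.le_induction with
  | base => exact h
  | succ n _ ih => exact ih (hP n h)

lemma infOnes_and_has10_of_limit {σseq : ℕ → Bool → List Bool} (hσ : ∀ n, IsLMR (σseq n))
    (hp : PrimitiveSeq σseq) {useq : ℕ → ℕ → Bool}
    (hu : ∀ n, useq n = substApply (σseq n) (useq (n + 1))) (k : ℕ) :
    InfOnes (useq k) ∧ Has10 (useq k) := by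
  have hones : ∀ k, InfOnes (useq k) := by
    intro k
    obtain ⟨n, hkn, hn⟩ : ∃ n, k ≤ n ∧ σseq n ≠ Lsub := by
      by_contra! hcon
      exact hp.1 ⟨k, hcon⟩
    refine backward_induction (P := fun n => InfOnes (useq n))
      (fun n h => by rw [hu n]; exact h.substApply (hσ n)) hkn ?_
    rw [hu n]
    rcases hσ n with h | h | h
    · exact absurd h hn
    · rw [h]; exact infOnes_opM _
    · rw [h]; exact infOnes_opR _
  refine ⟨hones k, ?_⟩
  obtain ⟨n, hkn, hn⟩ : ∃ n, k ≤ n ∧ σseq n ≠ Rsub := by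
    by_contra! hcon
    exact hp.2 ⟨k, hcon⟩
  refine backward_induction (P := fun n => Has10 (useq n))
    (fun n h => by rw [hu n]; exact h.substApply (hσ n)) hkn ?_
  rw [hu n]
  rcases hσ n with h | h | h
  · obtain ⟨j, hj⟩ := hones (n + 1) _ (.refl _)
    have hs : IsSuf (fun i => useq (n + 1) (i + j)) (useq (n + 1)) := ⟨j, rfl⟩
    have := hs.opL
    rw [opL_true (by simpa using hj)] at this
    rw [h]
    exact ⟨_, this.tl, rfl, opL_zero _⟩
  · rw [h]; exact has10_opM _
  · exact absurd h hn

lemma limit_eq_applyList {σseq : ℕ → Bool → List Bool} {useq : ℕ → ℕ → Bool}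
    (hu : ∀ n, useq n = substApply (σseq n) (useq (n + 1))) (n : ℕ) :
    useq 0 = applyList ((List.range n).map σseq) (useq n) := by
  induction n with
  | zero => rfl
  | succ n ih =>
    rw [ih, List.range_succ, List.map_append, applyList_append, hu n]
    rfl

lemma infOnes_of_mem_Sset {u : ℕ → Bool} (h : u ∈ Sset) : InfOnes u := by
  obtain ⟨σseq, hσ, hp, useq, rfl, hu⟩ := h
  exact (infOnes_and_has10_of_limit hσ hp hu 0).1

lemma approximable_of_mem_Sset {u : ℕ → Bool} (h : u ∈ Sset) : Approximable u := by
  obtain ⟨σseq, hσ, hp, useq, rfl, hu⟩ := h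
  refine approximable_of_approx fun n => ⟨(List.range n).map σseq, ?_, fun y => ?_⟩
  · intro τ hτ
    obtain ⟨i, -, rfl⟩ := List.mem_map.1 hτ
    exact hσ i
  · have hl : ∀ τ ∈ (List.range n).map σseq, IsLMR τ := by
      intro τ hτ
      obtain ⟨i, -, rfl⟩ := List.mem_map.1 hτ
      exact hσ i
    have := (Approx.base (x := consB false y) rfl
      (infOnes_and_has10_of_limit hσ hp hu n).2).applyList hl
    rw [← limit_eq_applyList hu n] at this
    simpa using this

/-! ### Images of different words differ early -/

lemma exists_ne_substApply_zero {σ : Bool → List Bool} (hσ : IsLMR σ) {x x' : ℕ → Bool}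
    (h : x 0 ≠ x' 0) : ∃ j ≤ 1, substApply σ x j ≠ substApply σ x' j := by
  have key : ∀ x x' : ℕ → Bool, x 0 = false → x' 0 = true →
      ∃ j ≤ 1, substApply σ x j ≠ substApply σ x' j := by
    intro x x' h0 h1
    rcases hσ with rfl | rfl | rfl
    · refine ⟨1, le_rfl, ?_⟩
      change opL x 1 ≠ opL x' 1
      rw [opL_false h0, opL_true h1]
      change opL (tl x) 0 ≠ true
      rw [opL_zero]
      decide
    · refine ⟨0, by omega, ?_⟩
      change opM x 0 ≠ opM x' 0
      rw [opM_zero, opM_zero, h0, h1]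
      decide
    · refine ⟨0, by omega, ?_⟩
      change opR x 0 ≠ opR x' 0
      rw [opR_zero, opR_zero, h0, h1]
      decide
  cases h0 : x 0 <;> cases h1 : x' 0
  · exact absurd (h0.trans h1.symm) h
  · exact key x x' h0 h1
  · obtain ⟨j, hj, hne⟩ := key x' x h1 h0
    exact ⟨j, hj, hne.symm⟩
  · exact absurd (h0.trans h1.symm) h

lemma exists_ne_substApply {σ : Bool → List Bool} (hσ : IsLMR σ) {i : ℕ} {x x' : ℕ → Bool}
    (h : x i ≠ x' i) : ∃ j ≤ 2 * i + 1, substApply σ x j ≠ substApply σ x' j := by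
  induction i generalizing x x' with
  | zero => exact exists_ne_substApply_zero hσ h
  | succ i ih =>
    by_cases h0 : x 0 = x' 0
    · obtain ⟨j, hj, hne⟩ := ih (x := tl x) (x' := tl x') h
      have hlen : (σ (x 0)).length ≤ 2 := by
        rcases hσ with rfl | rfl | rfl <;> cases x 0 <;> simp [Lsub, Msub, Rsub]
      refine ⟨j + (σ (x 0)).length, by omega, ?_⟩
      rw [substApply_eq hσ.ne_nil x, substApply_eq hσ.ne_nil x', ← h0]
      simpa [appendW] using hne
    · obtain ⟨j, hj, hne⟩ := exists_ne_substApply_zero hσ h0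
      exact ⟨j, by omega, hne⟩

lemma exists_ne_applyList {l : List (Bool → List Bool)} (hl : ∀ τ ∈ l, IsLMR τ) {i : ℕ}
    {x x' : ℕ → Bool} (h : x i ≠ x' i) :
    ∃ j, j + 1 ≤ 2 ^ l.length * (i + 1) ∧ applyList l x j ≠ applyList l x' j := by
  induction l with
  | nil => exact ⟨i, by simp, h⟩
  | cons τ l ih =>
    obtain ⟨j, hj, hne⟩ := ih fun τ' h => hl τ' (by simp [h])
    obtain ⟨k, hk, hne'⟩ := exists_ne_substApply (hl τ (by simp)) hne
    refine ⟨k, ?_, hne'⟩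
    rw [List.length_cons, pow_succ]
    linarith

/-! ### Suprema and infima of orbits -/

lemma lexSupSeq_eq_true {S : Set (ℕ → Bool)} {n : ℕ} :
    lexSupSeq S n = true ↔ ∃ u ∈ S, (∀ i, i < n → u i = lexSupSeq S i) ∧ u n = true := by
  classical
  rw [lexSupSeq, decide_eq_true_eq]

lemma lexInfSeq_eq_false {S : Set (ℕ → Bool)} {n : ℕ} :
    lexInfSeq S n = false ↔ ∃ u ∈ S, (∀ i, i < n → u i = lexInfSeq S i) ∧ u n = false := by
  rw [lexInfSeq, decide_eq_false_iff_not, not_not]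

lemma prefLe_lexSupSeq {S : Set (ℕ → Bool)} {u : ℕ → Bool} (hu : u ∈ S) (n : ℕ) :
    PrefLe n u (lexSupSeq S) := by
  intro j _ hij
  cases hj : u j
  · exact Bool.false_le _
  · rw [lexSupSeq_eq_true.2 ⟨u, hu, hij, hj⟩]

lemma lexInfSeq_prefLe {S : Set (ℕ → Bool)} {u : ℕ → Bool} (hu : u ∈ S) (n : ℕ) :
    PrefLe n (lexInfSeq S) u := by
  intro j _ hij
  cases hj : u j
  · rw [lexInfSeq_eq_false.2 ⟨u, hu, fun i hi => (hij i hi).symm, hj⟩]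
  · exact Bool.le_true _

lemma exists_eq_lexSupSeq {S : Set (ℕ → Bool)} (hS : S.Nonempty) (n : ℕ) :
    ∃ u ∈ S, ∀ i < n, u i = lexSupSeq S i := by
  induction n with
  | zero => exact ⟨_, hS.some_mem, fun i hi => absurd hi (Nat.not_lt_zero i)⟩
  | succ n ih =>
    cases hn : lexSupSeq S n
    · obtain ⟨u, hu, h⟩ := ih
      refine ⟨u, hu, fun i hi => ?_⟩
      rcases Nat.lt_succ_iff_lt_or_eq.1 hi with hi | rfl
      · exact h i hi
      · have := prefLe_lexSupSeq hu (i + 1) i (Nat.lt_succ_self i) h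
        rw [hn] at this ⊢
        exact le_bot_iff.mp this
    · obtain ⟨u, hu, h, h1⟩ := lexSupSeq_eq_true.1 hn
      refine ⟨u, hu, fun i hi => ?_⟩
      rcases Nat.lt_succ_iff_lt_or_eq.1 hi with hi | rfl
      · exact h i hi
      · rw [h1, hn]

lemma exists_eq_lexInfSeq {S : Set (ℕ → Bool)} (hS : S.Nonempty) (n : ℕ) :
    ∃ u ∈ S, ∀ i < n, u i = lexInfSeq S i := by
  induction n with
  | zero => exact ⟨_, hS.some_mem, fun i hi => absurd hi (Nat.not_lt_zero i)⟩
  | succ n ih =>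
    cases hn : lexInfSeq S n
    · obtain ⟨u, hu, h, h1⟩ := lexInfSeq_eq_false.1 hn
      refine ⟨u, hu, fun i hi => ?_⟩
      rcases Nat.lt_succ_iff_lt_or_eq.1 hi with hi | rfl
      · exact h i hi
      · rw [h1, hn]
    · obtain ⟨u, hu, h⟩ := ih
      refine ⟨u, hu, fun i hi => ?_⟩
      rcases Nat.lt_succ_iff_lt_or_eq.1 hi with hi | rfl
      · exact h i hi
      · have := lexInfSeq_prefLe hu (i + 1) i (Nat.lt_succ_self i) fun k hk => (h k hk).symm
        rw [hn] at this ⊢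
        exact top_le_iff.mp this

lemma orbit_nonempty (u : ℕ → Bool) : (orbit u).Nonempty := ⟨_, IsSuf.refl u⟩

lemma IsSuf.prefLe_supO {v u : ℕ → Bool} (h : IsSuf v u) (n : ℕ) : PrefLe n v (supO u) :=
  prefLe_lexSupSeq h n

lemma IsSuf.infO_prefLe {v u : ℕ → Bool} (h : IsSuf v u) (n : ℕ) : PrefLe n (infO u) v :=
  lexInfSeq_prefLe h n

lemma PrefLe.congr_left {n : ℕ} {v v' w : ℕ → Bool} (h : PrefLe n v w)
    (hv : ∀ i < n, v i = v' i) : PrefLe n v' w := by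
  intro j hj hij
  rw [← hv j hj]
  exact h j hj fun i hi => by rw [hv i (hi.trans hj), hij i hi]

lemma isSuf_infO_prefLe_supO {v u : ℕ → Bool} (h : IsSuf v (infO u)) (n : ℕ) :
    PrefLe n v (supO u) := by
  obtain ⟨k, rfl⟩ := h
  obtain ⟨w, hw, hwi⟩ := exists_eq_lexInfSeq (orbit_nonempty u) (n + k)
  obtain ⟨l, rfl⟩ := hw
  have hs : IsSuf (fun i => u (i + (k + l))) u := ⟨k + l, rfl⟩
  refine (hs.prefLe_supO n).congr_left fun i hi => ?_
  have := hwi (i + k) (by omega)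
  simp only at this
  rw [← Nat.add_assoc, this]
  rfl

lemma InfOnes.supO_zero {u : ℕ → Bool} (h : InfOnes u) : supO u 0 = true := by
  obtain ⟨k, hk⟩ := h u (.refl u)
  have hs : IsSuf (fun i => u (i + k)) u := ⟨k, rfl⟩
  exact (hs.prefLe_supO 1).eq_true one_pos (by simpa using hk)

lemma InfOnes.supO {u : ℕ → Bool} (h : InfOnes u) (N : ℕ) : ∃ i ≥ N, supO u i = true := by
  by_contra! hcon
  simp only [Bool.not_eq_true] at hcon
  obtain ⟨w, hw, hwi⟩ := exists_eq_lexSupSeq (orbit_nonempty u) N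
  change IsSuf w u at hw
  have hzero : ∀ i, N ≤ i → w i = false := by
    intro i
    induction i using Nat.strong_induction_on with
    | _ i ih =>
      intro hi
      have := hw.prefLe_supO (i + 1) i (Nat.lt_succ_self i) fun j hj => ?_
      · rw [hcon i hi] at this
        exact le_bot_iff.mp this
      · rcases lt_or_ge j N with hjN | hjN
        · exact hwi j hjN
        · rw [ih j hj hjN, hcon j hjN]
  obtain ⟨l, rfl⟩ := hw
  obtain ⟨k, hk⟩ := h (fun i => u (i + (N + l))) ⟨_, rfl⟩
  have := hzero (k + N) (by omega)
  simp only [Nat.add_assoc] at this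
  simp only [this] at hk
  exact absurd hk (by decide)

/-! ### Expansions in base `β` -/

lemma piR_bR (β : ℝ) (u : ℕ → Bool) : piR β (bR u) = piB β u := rfl

lemma bR_nonneg (u : ℕ → Bool) (k : ℕ) : 0 ≤ bR u k := by
  unfold bR; split_ifs <;> norm_num

lemma bR_le_one (u : ℕ → Bool) (k : ℕ) : bR u k ≤ 1 := by
  unfold bR; split_ifs <;> norm_num

lemma bR_of_true {u : ℕ → Bool} {k : ℕ} (h : u k = true) : bR u k = 1 := by simp [bR, h]

lemma bR_of_false {u : ℕ → Bool} {k : ℕ} (h : u k = false) : bR u k = 0 := by simp [bR, h]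

lemma hasSum_inv_pow {β : ℝ} (hβ : 1 < β) :
    HasSum (fun k : ℕ => 1 / β ^ (k + 1)) (1 / (β - 1)) := by
  have h := (hasSum_geometric_of_lt_one (inv_nonneg.2 (by linarith))
    (inv_lt_one_of_one_lt₀ hβ)).mul_left β⁻¹
  have h0 : β ≠ 0 := by linarith
  have e1 : (fun k : ℕ => 1 / β ^ (k + 1)) = fun k : ℕ => β⁻¹ * β⁻¹ ^ k := by
    funext k; rw [one_div, ← inv_pow, pow_succ, mul_comm]
  have e2 : 1 / (β - 1) = β⁻¹ * (1 - β⁻¹)⁻¹ := by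
    rw [← mul_inv, mul_sub, mul_one, mul_inv_cancel₀ h0, one_div]
  rwa [e1, e2]

lemma summable_piR {β c : ℝ} (hβ : 1 < β) {u : ℕ → ℝ} (hu : ∀ k, u k ∈ Set.Icc 0 c) :
    Summable fun k => u k / β ^ (k + 1) := by
  have hpos : 0 < β := by linarith
  refine Summable.of_nonneg_of_le (fun k => div_nonneg (hu k).1 (by positivity)) (fun k => ?_)
    ((hasSum_inv_pow hβ).summable.mul_left c)
  rw [mul_one_div]
  exact div_le_div_of_nonneg_right (hu k).2 (by positivity)

lemma piR_const {β : ℝ} (hβ : 1 < β) (c : ℝ) : piR β (fun _ => c) = c / (β - 1) := by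
  have := ((hasSum_inv_pow hβ).mul_left c).tsum_eq
  simp only [mul_one_div] at this
  exact this

lemma piR_mono {β c c' : ℝ} (hβ : 1 < β) {u v : ℕ → ℝ} (hu : ∀ k, u k ∈ Set.Icc 0 c)
    (hv : ∀ k, v k ∈ Set.Icc 0 c') (h : ∀ k, u k ≤ v k) : piR β u ≤ piR β v := by
  have hpos : 0 < β := by linarith
  exact (summable_piR hβ hu).tsum_le_tsum
    (fun k => div_le_div_of_nonneg_right (h k) (by positivity)) (summable_piR hβ hv)

lemma piR_nonneg {β c : ℝ} (hβ : 1 < β) {u : ℕ → ℝ} (hu : ∀ k, u k ∈ Set.Icc 0 c) :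
    0 ≤ piR β u := by
  have hpos : 0 < β := by linarith
  exact tsum_nonneg fun k => div_nonneg (hu k).1 (by positivity)

lemma piR_le {β c : ℝ} (hβ : 1 < β) {u : ℕ → ℝ} (hu : ∀ k, u k ∈ Set.Icc 0 c) :
    piR β u ≤ c / (β - 1) := by
  rw [← piR_const hβ]
  exact piR_mono hβ hu (fun _ => ⟨(hu 0).1.trans (hu 0).2, le_rfl⟩) fun k => (hu k).2

lemma piR_succ {β c : ℝ} (hβ : 1 < β) {u : ℕ → ℝ} (hu : ∀ k, u k ∈ Set.Icc 0 c) :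
    β * piR β u = u 0 + piR β fun i => u (i + 1) := by
  have hpos : β ≠ 0 := by linarith
  have hs := (summable_piR hβ hu)
  have hs' : Summable fun k => u (k + 1) / β ^ (k + 1) :=
    summable_piR hβ (u := fun i => u (i + 1)) fun k => hu _
  rw [piR, hs.tsum_eq_zero_add, piR, mul_add, ← tsum_mul_left]
  congr 1
  · field_simp
    simp [mul_comm]
  · congr 1
    funext k
    rw [pow_succ β (k + 1)]
    field_simp

lemma piR_lt_of_lt {β γ c : ℝ} (hβ : 1 < β) (hβγ : β < γ) {u : ℕ → ℝ}
    (hu : ∀ k, u k ∈ Set.Icc 0 c) {i : ℕ} (hi : 0 < u i) : piR γ u < piR β u := by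
  have hpos : 0 < β := by linarith
  refine Summable.tsum_lt_tsum (i := i) (fun k => ?_) ?_ (summable_piR (hβ.trans hβγ) hu)
    (summable_piR hβ hu)
  · exact div_le_div_of_nonneg_left (hu k).1 (by positivity)
      (pow_le_pow_left₀ hpos.le hβγ.le _)
  · exact div_lt_div_of_pos_left hi (by positivity)
      (pow_lt_pow_left₀ hβγ hpos.le (Nat.succ_ne_zero _))

lemma continuousOn_piR {a c : ℝ} (ha : 1 < a) {u : ℕ → ℝ} (hu : ∀ k, u k ∈ Set.Icc 0 c) :
    ContinuousOn (fun β => piR β u) (Set.Ici a) := by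
  refine continuousOn_tsum (fun k => ?_) (summable_piR ha hu) fun k β hβ => ?_
  · refine continuousOn_const.div (continuousOn_id.pow _) fun β hβ => ?_
    have : a ≤ β := hβ
    exact pow_ne_zero _ (by linarith : β ≠ 0)
  · have hβ' : a ≤ β := hβ
    have hpos : 0 < a := by linarith
    rw [Real.norm_of_nonneg (div_nonneg (hu k).1 (pow_nonneg (by linarith) _))]
    exact div_le_div_of_nonneg_left (hu k).1 (by positivity) (pow_le_pow_left₀ hpos.le hβ' _)

lemma bR_mem_Icc (u : ℕ → Bool) (k : ℕ) : bR u k ∈ Set.Icc (0 : ℝ) 1 :=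
  ⟨bR_nonneg u k, bR_le_one u k⟩

lemma piB_nonneg {β : ℝ} (hβ : 1 < β) (u : ℕ → Bool) : 0 ≤ piB β u :=
  piR_nonneg hβ (bR_mem_Icc u)

lemma piB_le {β : ℝ} (hβ : 1 < β) (u : ℕ → Bool) : piB β u ≤ 1 / (β - 1) :=
  piR_le hβ (bR_mem_Icc u)

lemma piB_succ {β : ℝ} (hβ : 1 < β) (u : ℕ → Bool) :
    β * piB β u = bR u 0 + piB β (tl u) :=
  piR_succ hβ (bR_mem_Icc u)

lemma piB_pos {β : ℝ} (hβ : 1 < β) {u : ℕ → Bool} {i : ℕ} (h : u i = true) : 0 < piB β u := by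
  have hpos : 0 < β := by linarith
  refine (summable_piR hβ (bR_mem_Icc u)).tsum_pos
    (fun k => div_nonneg (bR_nonneg u k) (by positivity)) i ?_
  rw [bR_of_true h]
  positivity

lemma not_summable_one {u : ℕ → Bool} (h : ∀ N, ∃ i ≥ N, u i = true) :
    ¬ Summable fun k => (if u k then (1 : ℝ) else 0) / 1 ^ (k + 1) := by
  intro hs
  obtain ⟨N, hN⟩ := Filter.eventually_atTop.1
    (hs.tendsto_atTop_zero.eventually (gt_mem_nhds one_pos))
  obtain ⟨i, hi, h1⟩ := h N
  have := hN i hi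
  simp [h1] at this

/-! ### The functions `f`, `g` and the value `μ` -/

/-- The defining equation `(β - 1)(1 + π_β(I)) = m` of `g`, in terms of a function decreasing
in `β`. -/
lemma piR_sub {β m : ℝ} (hβ : 1 < β) (I : ℕ → Bool) :
    piR β (fun k => m - bR I k) = m / (β - 1) - piB β I := by
  have h1 : Summable fun k : ℕ => m / β ^ (k + 1) := by
    simpa only [mul_one_div] using (hasSum_inv_pow hβ).summable.mul_left m
  have h2 := h1.tsum_sub (summable_piR hβ (bR_mem_Icc I))
  simp only [← sub_div] at h2
  rw [piR, h2, ← piR_const hβ m]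
  rfl

lemma sub_bR_mem_Icc {m : ℝ} (hm : 1 < m) (I : ℕ → Bool) (k : ℕ) :
    m - bR I k ∈ Set.Icc 0 m :=
  ⟨by linarith [bR_le_one I k], by linarith [bR_nonneg I k]⟩

lemma lt_mul_iff {β m : ℝ} (hβ : 1 < β) (p : ℝ) :
    m < (β - 1) * (1 + p) ↔ m / (β - 1) - p < 1 := by
  rw [sub_lt_iff_lt_add, div_lt_iff₀ (by linarith), mul_comm]

lemma eq_mul_iff {β m : ℝ} (hβ : 1 < β) (p : ℝ) :
    (β - 1) * (1 + p) = m ↔ m / (β - 1) - p = 1 := by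
  have : β - 1 ≠ 0 := by linarith
  rw [sub_eq_iff_eq_add, div_eq_iff this, mul_comm, eq_comm]

lemma piR_sub_lt {β γ m : ℝ} (hm : 1 < m) (hβ : 1 < β) (hβγ : β < γ) (I : ℕ → Bool) :
    m / (γ - 1) - piB γ I < m / (β - 1) - piB β I := by
  rw [← piR_sub hβ, ← piR_sub (hβ.trans hβγ)]
  exact piR_lt_of_lt hβ hβγ (sub_bR_mem_Icc hm I) (i := 0) (by linarith [bR_le_one I 0])

section

variable {u : ℕ → Bool} {β γ m : ℝ}

lemma mul_piB_supO (hu : InfOnes u) (hβ : 1 < β) :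
    β * piB β (supO u) = 1 + piB β (tl (supO u)) := by
  rw [piB_succ hβ, bR_of_true hu.supO_zero]

lemma mul_piB_supO_lt (hu : InfOnes u) (hβ : 1 < β) (hβγ : β < γ) :
    γ * piB γ (supO u) < β * piB β (supO u) := by
  rw [mul_piB_supO hu hβ, mul_piB_supO hu (hβ.trans hβγ)]
  obtain ⟨i, hi, h1⟩ := hu.supO 1
  have := piR_lt_of_lt hβ hβγ (bR_mem_Icc (tl (supO u))) (i := i - 1) (by
    rw [bR_of_true (show tl (supO u) (i - 1) = true by rwa [tl, Nat.sub_add_cancel hi])]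
    exact one_pos)
  rw [piR_bR, piR_bR] at this
  linarith

lemma mul_piB_supO_injective (hu : InfOnes u) (hβ : 1 < β) (hγ : 1 < γ)
    (h : β * piB β (supO u) = γ * piB γ (supO u)) : β = γ := by
  rcases lt_trichotomy β γ with hlt | heq | hlt
  · exact absurd h (mul_piB_supO_lt hu hβ hlt).ne'
  · exact heq
  · exact absurd h (mul_piB_supO_lt hu hγ hlt).ne

lemma fVal_eq (hu : InfOnes u) (hβ : 1 < β) (hm : m ≠ 0) (h : β * piB β (supO u) = m) :
    fVal u m = β := by
  have : {β : ℝ | 1 ≤ β ∧ β * piB β (supO u) = m} = {β} := by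
    refine Set.eq_singleton_iff_unique_mem.2 ⟨⟨hβ.le, h⟩, fun γ ⟨h1, h2⟩ => ?_⟩
    rcases h1.eq_or_lt with rfl | h1
    · rw [piB, tsum_eq_zero_of_not_summable (not_summable_one hu.supO)] at h2
      exact absurd h2 (by simpa using hm.symm)
    · exact mul_piB_supO_injective hu h1 hβ (h2.trans h.symm)
  rw [fVal, this, csInf_singleton]

lemma gVal_eq (hm : 1 < m) (hβ : 1 < β) (h : (β - 1) * (1 + piB β (infO u)) = m) :
    gVal u m = β := by
  have : {β : ℝ | 1 < β ∧ (β - 1) * (1 + piB β (infO u)) = m} = {β} := by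
    refine Set.eq_singleton_iff_unique_mem.2 ⟨⟨hβ, h⟩, fun γ ⟨h1, h2⟩ => ?_⟩
    rw [eq_mul_iff hβ] at h
    rw [eq_mul_iff h1] at h2
    rcases lt_trichotomy γ β with hlt | heq | hlt
    · exact absurd (h2.trans h.symm) (piR_sub_lt hm h1 hlt _).ne'
    · exact heq
    · exact absurd (h2.trans h.symm) (piR_sub_lt hm hβ hlt _).ne
  rw [gVal, this, csInf_singleton]

lemma one_lt_mul_piB_supO (hu : InfOnes u) (hβ : 1 < β) : 1 < β * piB β (supO u) := by
  rw [mul_piB_supO hu hβ]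
  obtain ⟨i, hi, h1⟩ := hu.supO 1
  have : tl (supO u) (i - 1) = true := by rwa [tl, Nat.sub_add_cancel hi]
  linarith [piB_pos hβ this]

lemma mul_piB_supO_le (hu : InfOnes u) (hβ : 1 < β) :
    β * piB β (supO u) ≤ 1 + 1 / (β - 1) := by
  rw [mul_piB_supO hu hβ]
  linarith [piB_le hβ (tl (supO u))]

lemma mul_one_add_piB_le (hβ : 1 < β) (I : ℕ → Bool) : (β - 1) * (1 + piB β I) ≤ β := by
  have h0 : 0 < β - 1 := by linarith
  have := mul_le_mul_of_nonneg_left (piB_le hβ I) h0.le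
  rw [mul_one_div, div_self h0.ne'] at this
  linarith

lemma exists_two_le_mul_piB_supO (hu : InfOnes u) :
    ∃ a, 1 < a ∧ a ≤ 2 ∧ 2 ≤ a * piB a (supO u) := by
  obtain ⟨i, hi, h1⟩ := hu.supO 1
  obtain ⟨j, hj, h2⟩ := hu.supO (i + 1)
  have ha : (1 : ℝ) < (2 : ℝ) ^ ((j : ℝ)⁻¹) := by
    have : (0 : ℝ) < j := by exact_mod_cast (show 0 < j by omega)
    exact Real.one_lt_rpow (by norm_num) (by positivity)
  have hpow : ((2 : ℝ) ^ ((j : ℝ)⁻¹)) ^ j = 2 :=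
    Real.rpow_inv_natCast_pow (by norm_num) (by omega)
  generalize (2 : ℝ) ^ ((j : ℝ)⁻¹) = a at ha hpow
  refine ⟨a, ha, ?_, ?_⟩
  · rw [← hpow]
    exact le_self_pow₀ ha.le (by omega)
  · rw [mul_piB_supO hu ha]
    have hterm : ∀ k, 1 ≤ k → k ≤ j → supO u k = true →
        1 / 2 ≤ bR (tl (supO u)) (k - 1) / a ^ (k - 1 + 1) := by
      intro k hk hkj hs
      rw [bR_of_true (show tl (supO u) (k - 1) = true by rwa [tl, Nat.sub_add_cancel hk]),
        Nat.sub_add_cancel hk]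
      refine one_div_le_one_div_of_le (pow_pos (by linarith) _) ?_
      rw [← hpow]
      exact pow_le_pow_right₀ ha.le hkj
    have := (summable_piR ha (bR_mem_Icc (tl (supO u)))).sum_le_tsum {i - 1, j - 1}
      fun k _ => div_nonneg (bR_nonneg _ k) (pow_nonneg (by linarith) _)
    rw [Finset.sum_pair (by omega)] at this
    have hi' := hterm i hi (by omega) h1
    have hj' := hterm j (by omega) le_rfl h2
    change _ ≤ piB a (tl (supO u)) at this
    linarith

lemma continuousOn_mul_piB {a : ℝ} (ha : 1 < a) (v : ℕ → Bool) :
    ContinuousOn (fun β => β * piB β v) (Set.Ici a) :=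
  continuousOn_id.mul (continuousOn_piR ha (bR_mem_Icc v))

lemma continuousOn_mul_one_add_piB {a : ℝ} (ha : 1 < a) (v : ℕ → Bool) :
    ContinuousOn (fun β => (β - 1) * (1 + piB β v)) (Set.Ici a) :=
  (continuousOn_id.sub continuousOn_const).mul
    (continuousOn_const.add (continuousOn_piR ha (bR_mem_Icc v)))

lemma fVal_spec (hu : InfOnes u) (hm : m ∈ Set.Ioc (1 : ℝ) 2) :
    1 < fVal u m ∧ fVal u m * piB (fVal u m) (supO u) = m := by
  obtain ⟨a, ha, -, ha2⟩ := exists_two_le_mul_piB_supO hu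
  have hm1 : 0 < m - 1 := by linarith [hm.1]
  have hb : a ≤ max a (1 + 1 / (m - 1)) := le_max_left _ _
  have hc : ContinuousOn (fun β => β * piB β (supO u)) (Set.Icc a (max a (1 + 1 / (m - 1)))) :=
    (continuousOn_mul_piB ha _).mono Set.Icc_subset_Ici_self
  have hle : max a (1 + 1 / (m - 1)) * piB (max a (1 + 1 / (m - 1))) (supO u) ≤ m := by
    refine (mul_piB_supO_le hu (ha.trans_le hb)).trans ?_
    have h1 : 1 / (m - 1) ≤ max a (1 + 1 / (m - 1)) - 1 := by
      linarith [le_max_right a (1 + 1 / (m - 1))]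
    have := one_div_le_one_div_of_le (one_div_pos.2 hm1) h1
    rw [one_div_one_div] at this
    linarith
  obtain ⟨β, hβ, h⟩ := intermediate_value_Icc' hb hc ⟨hle, hm.2.trans ha2⟩
  have hβ1 : 1 < β := ha.trans_le hβ.1
  rw [fVal_eq hu hβ1 (by linarith [hm.1]) h]
  exact ⟨hβ1, h⟩

lemma gVal_spec (u : ℕ → Bool) (hm : m ∈ Set.Ioc (1 : ℝ) 2) :
    1 < gVal u m ∧ (gVal u m - 1) * (1 + piB (gVal u m) (infO u)) = m := by
  have hc := (continuousOn_mul_one_add_piB hm.1 (infO u)).mono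
    (Set.Icc_subset_Ici_self : Set.Icc m 4 ⊆ _)
  obtain ⟨β, hβ, h⟩ := intermediate_value_Icc (by linarith [hm.2]) hc
    (show m ∈ _ from ⟨mul_one_add_piB_le hm.1 _, by
      have := piB_nonneg (β := 4) (by norm_num) (infO u)
      linarith [hm.2]⟩)
  have hβ1 : 1 < β := hm.1.trans_le hβ.1
  rw [gVal_eq hm.1 hβ1 h]
  exact ⟨hβ1, h⟩

lemma exists_crossing (hu : InfOnes u) : ∃ β, 1 < β ∧ β * piB β (supO u) ≤ 2 ∧
    (β - 1) * (1 + piB β (infO u)) = β * piB β (supO u) := by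
  obtain ⟨a, ha, ha2, hF⟩ := exists_two_le_mul_piB_supO hu
  have hc : ContinuousOn (fun β => β * piB β (supO u) - (β - 1) * (1 + piB β (infO u)))
      (Set.Icc a 4) :=
    ((continuousOn_mul_piB ha _).sub (continuousOn_mul_one_add_piB ha _)).mono
      Set.Icc_subset_Ici_self
  obtain ⟨β, hβ, h⟩ := intermediate_value_Icc' (by linarith) hc (show (0 : ℝ) ∈ _ from ⟨by
    have h1 := mul_piB_supO_le hu (β := 4) (by norm_num)
    have h2 := piB_nonneg (β := 4) (by norm_num) (infO u)
    norm_num at h1 ⊢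
    linarith, by
    have := mul_one_add_piB_le ha (infO u)
    linarith⟩)
  have hβ1 : 1 < β := ha.trans_le hβ.1
  simp only at h
  refine ⟨β, hβ1, ?_, by linarith⟩
  rcases le_total β 2 with h2 | h2
  · linarith [mul_one_add_piB_le hβ1 (infO u)]
  · have h1 := mul_piB_supO_le hu hβ1
    have : 1 / (β - 1) ≤ 1 / 1 := one_div_le_one_div_of_le one_pos (by linarith)
    linarith

lemma sub_piB_mono {m' : ℝ} (hβ : 1 < β) (h : m ≤ m') (p : ℝ) :
    m / (β - 1) - p ≤ m' / (β - 1) - p := by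
  have : 0 < β - 1 := by linarith
  gcongr

lemma crossing_le (hu : InfOnes u) (hβ : 1 < β) (hγ : 1 < γ)
    (h : (β - 1) * (1 + piB β (infO u)) = β * piB β (supO u))
    (h' : (γ - 1) * (1 + piB γ (infO u)) = γ * piB γ (supO u)) : β ≤ γ := by
  by_contra! hlt
  have h1 := mul_piB_supO_lt hu hγ hlt
  rw [eq_mul_iff hβ] at h
  rw [eq_mul_iff hγ] at h'
  have h2 := piR_sub_lt (one_lt_mul_piB_supO hu hγ) hγ hlt (infO u)
  have h3 := sub_piB_mono hβ h1.le (piB β (infO u))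
  linarith

lemma muVal_spec (hu : InfOnes u) : ∃ β, 1 < β ∧ β * piB β (supO u) = muVal u ∧
    (β - 1) * (1 + piB β (infO u)) = muVal u := by
  obtain ⟨β, hβ, h2, h⟩ := exists_crossing hu
  have h1 := one_lt_mul_piB_supO hu hβ
  have : {m : ℝ | 1 < m ∧ m ≤ 2 ∧ fVal u m = gVal u m} = {β * piB β (supO u)} := by
    refine Set.eq_singleton_iff_unique_mem.2 ⟨⟨h1, h2, ?_⟩, fun m ⟨hm1, hm2, hfg⟩ => ?_⟩
    · rw [fVal_eq hu hβ (by linarith) rfl, gVal_eq h1 hβ h]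
    · obtain ⟨hf1, hf⟩ := fVal_spec hu ⟨hm1, hm2⟩
      obtain ⟨-, hg⟩ := gVal_spec u ⟨hm1, hm2⟩
      rw [← hfg] at hg
      rw [← hf, (crossing_le hu hβ hf1 h (hg.trans hf.symm)).antisymm
        (crossing_le hu hf1 hβ (hg.trans hf.symm) h)]
  refine ⟨β, hβ, ?_⟩
  rw [muVal, this, csInf_singleton]
  exact ⟨rfl, h⟩

lemma one_lt_muVal (hu : InfOnes u) : 1 < muVal u := by
  obtain ⟨β, hβ, h, -⟩ := muVal_spec hu
  rw [← h]
  exact one_lt_mul_piB_supO hu hβ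

lemma lt_of_gVal_lt (hu : InfOnes u) (hm : m ∈ Set.Ioc (1 : ℝ) 2) (hμ : muVal u ≤ m)
    (hβ : gVal u m < β) : 1 < β ∧ β * piB β (supO u) < m ∧
      m < (β - 1) * (1 + piB β (infO u)) := by
  obtain ⟨b, hb, hF, hG⟩ := muVal_spec hu
  obtain ⟨hg1, hg⟩ := gVal_spec u hm
  have hβ1 := hg1.trans hβ
  rw [eq_mul_iff hb] at hG
  rw [eq_mul_iff hg1] at hg
  have hbg : b ≤ gVal u m := by
    by_contra! hlt
    linarith [piR_sub_lt hm.1 hg1 hlt (infO u), sub_piB_mono hb hμ (piB b (infO u))]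
  refine ⟨hβ1, ?_, ?_⟩
  · linarith [mul_piB_supO_lt hu hb (hbg.trans_lt hβ)]
  · rw [lt_mul_iff hβ1]
    linarith [piR_sub_lt hm.1 hg1 hβ (infO u)]

lemma lt_of_fVal_lt (hu : InfOnes u) (hm : m ∈ Set.Ioc (1 : ℝ) 2) (hμ : m ≤ muVal u)
    (hβ : fVal u m < β) : 1 < β ∧ β * piB β (supO u) < m ∧
      m < (β - 1) * (1 + piB β (infO u)) := by
  obtain ⟨b, hb, hF, hG⟩ := muVal_spec hu
  obtain ⟨hf1, hf⟩ := fVal_spec hu hm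
  have hβ1 := hf1.trans hβ
  rw [eq_mul_iff hb] at hG
  have hbf : b ≤ fVal u m := by
    by_contra! hlt
    linarith [mul_piB_supO_lt hu hf1 hlt]
  refine ⟨hβ1, ?_, ?_⟩
  · linarith [mul_piB_supO_lt hu hf1 hβ]
  · rw [lt_mul_iff hβ1]
    linarith [piR_sub_lt (one_lt_muVal hu) hb (hbf.trans_lt hβ) (infO u),
      sub_piB_mono hβ1 hμ (piB β (infO u))]

end

/-! ### Univoque expansions -/

lemma piB_le_of_prefLe {β E : ℝ} (hβ : 1 < β) (hE : 0 ≤ E) {n : ℕ} {v w : ℕ → Bool}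
    (h : PrefLe n v w) (hv : ∀ s, IsSuf s v → piB β s ≤ 1 + E) :
    piB β v ≤ piB β w + 1 / (β - 1) / β ^ n + E / β := by
  have hpos : 0 < β := by linarith
  induction n generalizing v w with
  | zero =>
    have h1 := piB_le hβ v
    have h2 := piB_nonneg hβ w
    have h3 : 0 ≤ E / β := by positivity
    rw [pow_zero, div_one]
    linarith
  | succ n ih =>
    have hC : 0 ≤ 1 / (β - 1) := one_div_nonneg.2 (by linarith)
    refine le_of_mul_le_mul_left ?_ hpos
    rw [mul_add, mul_add, piB_succ hβ, piB_succ hβ, mul_div_cancel₀ _ hpos.ne', pow_succ,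
      ← div_div, mul_div_cancel₀ _ hpos.ne']
    have hCn : 0 ≤ 1 / (β - 1) / β ^ n := by positivity
    by_cases h0 : v 0 = w 0
    · have hih := ih (h.tl h0) fun s hs => hv s (consB_tl v ▸ hs.tl_of_consB)
      have : E / β ≤ E := div_le_self hE hβ.le
      simp only [bR, h0]
      linarith
    · cases v0 : v 0
      · have w0 : w 0 = true := by
          cases w0 : w 0
          · exact absurd (v0.trans w0.symm) h0
          · rfl
        rw [bR_of_false v0, bR_of_true w0]
        have := hv (tl v) (IsSuf.refl v).tl
        linarith [piB_nonneg hβ (tl w)]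
      · exact absurd (v0.trans (h.eq_true (Nat.succ_pos n) v0).symm) h0

lemma piB_le_of_forall_prefLe {β δ : ℝ} (hβ : 1 < β) {n : ℕ} {x S : ℕ → Bool}
    (hx : ∀ s, IsSuf s x → PrefLe n s S) (hS : piB β S ≤ 1 - 2 * δ) (hδ : 0 ≤ δ)
    (hn : 1 / (β - 1) / β ^ n ≤ δ) {v : ℕ → Bool} (hv : IsSuf v x) : piB β v ≤ 1 - δ := by
  have hpos : 0 < β := by linarith
  have hC : 0 ≤ 1 / (β - 1) := one_div_nonneg.2 (by linarith)
  have key : ∀ k : ℕ, ∀ s, IsSuf s x → piB β s ≤ 1 - δ + 1 / (β - 1) / β ^ k := by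
    intro k
    induction k with
    | zero =>
      intro s _
      rw [pow_zero, div_one]
      linarith [piB_le hβ s, piB_nonneg hβ S]
    | succ k ih =>
      intro s hs
      have hE : 0 ≤ 1 / (β - 1) / β ^ k := by positivity
      have := piB_le_of_prefLe hβ hE (hx s hs) fun t ht => by linarith [ih t (ht.trans hs)]
      rw [pow_succ, ← div_div]
      linarith
  have hlim : Filter.Tendsto (fun k : ℕ => 1 - δ + 1 / (β - 1) / β ^ k) Filter.atTop
      (nhds (1 - δ + 0)) :=
    tendsto_const_nhds.add
      (tendsto_const_nhds.div_atTop (tendsto_pow_atTop_atTop_of_one_lt hβ))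
  rw [add_zero] at hlim
  exact ge_of_tendsto' hlim fun k => key k v hv

/-- Bounds on the values of all suffixes of `x` which make the expansion `x` unique, with gaps
of size `η`. -/
def Admissible (β m η : ℝ) (x : ℕ → Bool) : Prop :=
  ∀ v, IsSuf v x → piB β v ≤ 1 - η ∧ m / (β - 1) - 1 < piB β v ∧ (v 0 = true → β * piB β v < m)

lemma Admissible.tl {β m η : ℝ} {x : ℕ → Bool} (h : Admissible β m η x) :
    Admissible β m η (tl x) :=
  fun v hv => h v (hv.trans (IsSuf.refl x).tl)

lemma exists_admissible {β m : ℝ} {u : ℕ → Bool} (hu : Approximable u) (hβ : 1 < β)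
    (hF : β * piB β (supO u) < m) (hG : m < (β - 1) * (1 + piB β (infO u))) :
    ∃ η > 0, ∃ l : List (Bool → List Bool), (∀ τ ∈ l, IsLMR τ) ∧
      ∀ y, Admissible β m η (applyList l (consB false y)) := by
  have hpos : 0 < β := by linarith
  have hm : m < β := hG.trans_le (mul_one_add_piB_le hβ _)
  have hS : piB β (supO u) < 1 := by
    by_contra! hcon
    linarith [mul_le_mul_of_nonneg_left hcon hpos.le]
  have hI : m / (β - 1) - 1 < piB β (infO u) := by
    rw [lt_mul_iff hβ] at hG
    linarith
  set δ := (1 - piB β (supO u)) / 2 with hδ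
  have hlim : Filter.Tendsto (fun k : ℕ => 1 / (β - 1) / β ^ k) Filter.atTop (nhds 0) :=
    tendsto_const_nhds.div_atTop (tendsto_pow_atTop_atTop_of_one_lt hβ)
  have hmin : 0 < min δ (min (m / β - piB β (supO u))
      (piB β (infO u) - (m / (β - 1) - 1))) := by
    refine lt_min (by linarith) (lt_min ?_ (by linarith))
    rw [sub_pos, lt_div_iff₀ hpos]
    linarith
  obtain ⟨n, hn⟩ := (hlim.eventually (gt_mem_nhds hmin)).exists
  obtain ⟨hn1, hn2⟩ := lt_min_iff.1 hn
  obtain ⟨hn2, hn3⟩ := lt_min_iff.1 hn2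
  obtain ⟨l, hl, hA⟩ := hu n
  refine ⟨δ, by linarith, l, hl, fun y v hv => ?_⟩
  have hsup : ∀ v, IsSuf v (applyList l (consB false y)) → PrefLe n v (supO u) := by
    intro v hv
    obtain ⟨w, hw, hle⟩ := (hA y v hv).1
    exact hle.trans (hw.prefLe_supO n)
  have hle : ∀ v, IsSuf v (applyList l (consB false y)) → piB β v ≤ 1 - δ := fun v hv =>
    piB_le_of_forall_prefLe hβ hsup (by linarith) (by linarith) hn1.le hv
  refine ⟨hle v hv, ?_, fun _ => ?_⟩
  · obtain ⟨w, hw, hwv⟩ := (hA y v hv).2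
    have := piB_le_of_prefLe hβ le_rfl ((hw.infO_prefLe n).trans hwv) fun s hs => by
      have := piB_le_of_forall_prefLe hβ (fun s hs => isSuf_infO_prefLe_supO hs n)
        (by linarith) (by linarith) hn1.le hs
      linarith
    rw [zero_div] at this
    linarith
  · have := piB_le_of_prefLe hβ le_rfl (hsup v hv) fun s hs => by
      linarith [hle s (hs.trans hv)]
    rw [zero_div] at this
    rw [mul_comm, ← lt_div_iff₀ hpos]
    linarith

lemma Admissible.piR_ne {β m η : ℝ} {x : ℕ → Bool} (h : Admissible β m η x) (hη : 0 < η)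
    (hβ : 1 < β) (hm : 1 < m) {v : ℕ → ℝ} (hv : ∀ k, v k ∈ ({0, 1, m} : Set ℝ))
    {k : ℕ} (hk : v k ≠ bR x k) : piR β v ≠ piB β x := by
  have hpos : 0 < β := by linarith
  have hmem : ∀ k, v k ∈ Set.Icc 0 m := by
    intro k
    rcases hv k with h | h | h
    · rw [h]; exact ⟨le_rfl, by linarith⟩
    · rw [h]; exact ⟨zero_le_one, hm.le⟩
    · rw [h]; exact ⟨by linarith, le_rfl⟩
  intro heq
  have hv1 := piR_succ hβ hmem
  rw [heq, piB_succ hβ] at hv1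
  by_cases h0 : v 0 = bR x 0
  · rw [h0, add_right_inj] at hv1
    match k, hk with
    | 0, hk => exact hk h0
    | k + 1, hk => exact h.tl.piR_ne hη hβ hm (fun k => hv (k + 1)) (k := k) hk hv1.symm
  · have ht0 := piR_nonneg hβ fun k => hmem (k + 1)
    have ht1 := piR_le hβ fun k => hmem (k + 1)
    obtain ⟨h1, h2, -⟩ := h _ (IsSuf.refl x).tl
    have h3 := (h x (.refl x)).2.2
    rw [piB_succ hβ] at h3
    cases x0 : x 0
    · rw [bR_of_false x0] at hv1 h0
      rcases hv 0 with h | h | h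
      · exact h0 h
      · linarith
      · linarith [show v 0 = m from h]
    · have h3 := h3 x0
      rw [bR_of_true x0] at hv1 h0 h3
      rcases hv 0 with h | h | h
      · linarith
      · exact h0 h
      · linarith [show v 0 = m from h]
termination_by k

lemma Admissible.bR_mem_Uset {β m η : ℝ} {x : ℕ → Bool} (h : Admissible β m η x) (hη : 0 < η)
    (hβ : 1 < β) (hm : 1 < m) : bR x ∈ Uset β {0, 1, m} := by
  refine ⟨fun k => ?_, fun v hv hne => ?_⟩
  · unfold bR
    split_ifs <;> simp
  · obtain ⟨k, hk⟩ := Function.ne_iff.1 hne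
    exact h.piR_ne hη hβ hm hv hk

lemma Admissible.le_abs_sub {β m η : ℝ} {x x' : ℕ → Bool} (h : Admissible β m η x)
    (h' : Admissible β m η x') (hη : 0 < η) (hβ : 1 < β) {j : ℕ} (hj : x j ≠ x' j) :
    η / β ^ (j + 1) ≤ |piB β x - piB β x'| := by
  have hpos : 0 < β := by linarith
  have key : ∀ x x' : ℕ → Bool, Admissible β m η x → x 0 = false → x' 0 = true →
      η ≤ |piB β x - piB β x'| * β := by
    intro x x' h x0 x0'
    have h1 := piB_succ hβ x
    have h2 := piB_succ hβ x'
    rw [bR_of_false x0] at h1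
    rw [bR_of_true x0'] at h2
    have h3 := (h _ (IsSuf.refl x).tl).1
    have h4 := piB_nonneg hβ (TernaryBases.tl x')
    have h5 := mul_le_mul_of_nonneg_right (neg_le_abs (piB β x - piB β x')) hpos.le
    linarith
  have hpow : ∀ j : ℕ, η / β ^ (j + 1) * β ≤ η := fun j => by
    rw [pow_succ, ← div_div, div_mul_cancel₀ _ hpos.ne']
    exact div_le_self hη.le (one_le_pow₀ hβ.le)
  induction j generalizing x x' with
  | zero =>
    refine le_of_mul_le_mul_right ((hpow 0).trans ?_) hpos
    cases x0 : x 0 <;> cases x0' : x' 0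
    · exact absurd (x0.trans x0'.symm) hj
    · exact key x x' h x0 x0'
    · rw [abs_sub_comm]
      exact key x' x h' x0' x0
    · exact absurd (x0.trans x0'.symm) hj
  | succ j ih =>
    refine le_of_mul_le_mul_right ?_ hpos
    cases x0 : x 0 <;> cases x0' : x' 0
    rotate_left
    · exact (hpow _).trans (key x x' h x0 x0')
    · rw [abs_sub_comm]
      exact (hpow _).trans (key x' x h' x0' x0)
    all_goals
      have h1 := ih h.tl h'.tl hj
      have h2 := piB_succ hβ x
      have h3 := piB_succ hβ x'
      have e : |piB β x - piB β x'| * β =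
          |piB β (TernaryBases.tl x) - piB β (TernaryBases.tl x')| := by
        rw [← abs_of_pos hpos, ← abs_mul, abs_of_pos hpos]
        congr 1
        simp only [bR, x0, x0'] at h2 h3
        linarith
      rw [e, pow_succ, ← div_div, div_mul_cancel₀ _ hpos.ne']
      exact h1

/-! ### Hausdorff dimension -/

lemma dimH_range_pos_of_separated {H : (ℕ → Fin 2) → ℝ} {q b : ℝ} (hq : 0 < q) (hb : 1 < b)
    (h : ∀ i d d', d i ≠ d' i → q / b ^ i ≤ |H d - H d'|) : 0 < dimH (Set.range H) := by
  have hinj : Function.Injective H := by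
    intro d d' hd
    by_contra hne
    obtain ⟨i, hi⟩ := Function.ne_iff.1 hne
    have := h i d d' hi
    rw [hd, sub_self, abs_zero] at this
    exact absurd this (not_le.2 (by positivity))
  have hb0 : 0 < b := by linarith
  have hlog : 0 < Real.log b := Real.log_pos hb
  set r : NNReal := (Real.log 2 / Real.log b).toNNReal with hr
  have hr_coe : (r : ℝ) = Real.log 2 / Real.log b :=
    Real.coe_toNNReal _ (div_nonneg (Real.log_nonneg (by norm_num)) hlog.le)
  have hr0 : 0 < r := Real.toNNReal_pos.2 (div_pos (Real.log_pos (by norm_num)) hlog)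
  have hbr : b ^ (r : ℝ) = 2 := by
    rw [hr_coe, Real.rpow_def_of_pos hb0, mul_div_cancel₀ _ hlog.ne', Real.exp_log (by norm_num)]
  set f : ℝ → ℝ := fun t => Real.ofDigits (Function.invFun H t)
  have hf : ∀ d, f (H d) = Real.ofDigits d := fun d => by
    simp only [f, Function.leftInverse_invFun hinj d]
  set C : NNReal := ((q⁻¹) ^ (r : ℝ)).toNNReal
  have hC : (C : ℝ) = (q⁻¹) ^ (r : ℝ) := Real.coe_toNNReal _ (by positivity)
  have hdist : ∀ d d', dist (f (H d)) (f (H d')) ≤ C * dist (H d) (H d') ^ (r : ℝ) := by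
    intro d d'
    rw [hf, hf, Real.dist_eq, Real.dist_eq]
    by_cases hne : d = d'
    · rw [hne, sub_self, abs_zero]
      positivity
    · have hex : ∃ i, d i ≠ d' i := Function.ne_iff.1 hne
      have h1 := Real.abs_ofDigits_sub_ofDigits_le (n := Nat.find hex)
        fun i hi => not_not.1 (Nat.find_min hex hi)
      refine h1.trans ?_
      have h2 := h _ d d' (Nat.find_spec hex)
      rw [hC, ← Real.mul_rpow (by positivity) (abs_nonneg _)]
      calc (((2 : ℕ) : ℝ) ^ Nat.find hex)⁻¹ = ((b ^ Nat.find hex)⁻¹) ^ (r : ℝ) := by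
            rw [Real.inv_rpow (by positivity), ← Real.rpow_natCast b, ← Real.rpow_mul hb0.le,
              mul_comm, Real.rpow_mul hb0.le, hbr, Real.rpow_natCast]
            norm_num
        _ ≤ (q⁻¹ * |H d - H d'|) ^ (r : ℝ) := by
            refine Real.rpow_le_rpow (by positivity) ?_ r.coe_nonneg
            rw [inv_mul_eq_div, le_div_iff₀ hq, mul_comm, ← div_eq_mul_inv]
            exact h2
  have hholder : HolderOnWith C r f (Set.range H) := by
    rintro _ ⟨d, rfl⟩ _ ⟨d', rfl⟩
    rw [edist_dist, edist_dist, ENNReal.ofReal_rpow_of_nonneg dist_nonneg r.coe_nonneg,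
      ← ENNReal.ofReal_coe_nnreal, ← ENNReal.ofReal_mul C.coe_nonneg]
    exact ENNReal.ofReal_le_ofReal (hdist d d')
  have himage : f '' Set.range H = Set.range (Real.ofDigits (b := 2)) := by
    rw [← Set.range_comp]
    congr 1
    exact funext hf
  have hone : 1 ≤ dimH (f '' Set.range H) := by
    have hIcc : dimH (Set.Icc (0 : ℝ) 1) = 1 := by
      rw [Real.dimH_of_nonempty_interior
        (by rw [interior_Icc]; exact ⟨1 / 2, by norm_num, by norm_num⟩),
        Module.finrank_self, Nat.cast_one]
    rw [himage, ← hIcc]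
    refine dimH_mono fun t ht => ?_
    obtain ⟨d, -, hd⟩ := Real.ofDigits_SurjOn (b := 2) (by norm_num) ht
    exact ⟨d, hd⟩
  by_contra! hcon
  have := hone.trans (hholder.dimH_image_le hr0)
  rw [nonpos_iff_eq_zero.1 hcon, ENNReal.zero_div] at this
  exact absurd this (by norm_num)

/-- The infinite binary words having unique expansions, with positive Hausdorff dimension. -/
lemma dimH_piR_image_binary_pos {β m : ℝ} {u : ℕ → Bool} (hu : Approximable u) (hm : 1 < m)
    (hβ : 1 < β) (hF : β * piB β (supO u) < m)
    (hG : m < (β - 1) * (1 + piB β (infO u))) :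
    0 < dimH (piR β '' (Uset β {0, 1, m} ∩ {v | ∃ u : ℕ → Bool, v = bR u})) := by
  obtain ⟨η, hη, l, hl, hA⟩ := exists_admissible hu hβ hF hG
  have hpos : 0 < β := by linarith
  set D := 2 ^ l.length
  have hD : 0 < D := by positivity
  set Φ : (ℕ → Fin 2) → ℕ → Bool := fun d =>
    applyList l (consB false fun i => decide (d i = 1)) with hΦ
  refine (dimH_range_pos_of_separated (H := fun d => piB β (Φ d)) (q := η / β ^ (D * 2))
    (b := β ^ D) (by positivity) (one_lt_pow₀ hβ hD.ne') fun i d d' hd => ?_).trans_le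
    (dimH_mono ?_)
  · have hne : consB false (fun i => decide (d i = 1)) (i + 1) ≠
        consB false (fun i => decide (d' i = 1)) (i + 1) := by
      rw [consB_succ, consB_succ]
      intro heq
      rw [decide_eq_decide] at heq
      omega
    obtain ⟨j, hj, hjne⟩ := exists_ne_applyList hl hne
    refine le_trans ?_ ((hA _).le_abs_sub (hA _) hη hβ hjne)
    rw [div_div, ← pow_mul, ← pow_add, ← mul_add]
    exact div_le_div_of_nonneg_left hη.le (by positivity)
      (pow_le_pow_right₀ hβ.le (hj.trans_eq (by ring)))
  · rintro _ ⟨d, rfl⟩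
    exact ⟨bR (Φ d), ⟨(hA _).bR_mem_Uset hη hβ hm, _, rfl⟩, piR_bR β _⟩

lemma Lval_le_and_dimH_pos {m b : ℝ} {u : ℕ → Bool} (hu : Approximable u) (hm : 1 < m)
    (h : ∀ β, b < β → 1 < β ∧ β * piB β (supO u) < m ∧
      m < (β - 1) * (1 + piB β (infO u))) :
    Lval m ≤ b ∧ ∀ β, b < β → 0 < dimH (piR β '' Uset β {0, 1, m}) := by
  have hdim : ∀ β, b < β →
      0 < dimH (piR β '' (Uset β {0, 1, m} ∩ {v | ∃ u : ℕ → Bool, v = bR u})) := by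
    intro β hβ
    obtain ⟨h1, hF, hG⟩ := h β hβ
    exact dimH_piR_image_binary_pos hu hm h1 hF hG
  refine ⟨le_of_forall_gt fun β hβ => ?_, fun β hβ =>
    (hdim β hβ).trans_le (dimH_mono (Set.image_mono Set.inter_subset_left))⟩
  obtain ⟨γ, hγ, hγβ⟩ := exists_between hβ
  refine lt_of_le_of_lt (csInf_le ⟨1, fun x hx => hx.1.le⟩ ⟨(h γ hγ).1, fun hc => ?_⟩) hγβ
  exact (hdim γ hγ).ne' (dimH_countable (hc.image _))

end TernaryBases

/-- Upper bounds for `𝓛(m)`, with positive Hausdorff dimension above each bound. -/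
theorem L_upper_bounds (m : ℝ) (hm : m ∈ Set.Ioc (1 : ℝ) 2) :
    (∀ σ ∈ LMRstar, muVal (substApply (compSub σ Msub) w10bar) ≤ m →
      Lval m ≤ gVal (substApply (compSub σ Msub) w10bar) m ∧
      ∀ β : ℝ, gVal (substApply (compSub σ Msub) w10bar) m < β →
        0 < dimH (piR β '' Uset β {0, 1, m})) ∧
    (∀ σ ∈ LMRstar, m ≤ muVal (substApply (compSub σ Msub) w01bar) →
      Lval m ≤ fVal (substApply (compSub σ Msub) w01bar) m ∧
      ∀ β : ℝ, fVal (substApply (compSub σ Msub) w01bar) m < β →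
        0 < dimH (piR β '' Uset β {0, 1, m})) ∧
    (muVal w01bar ≤ m →
      Lval m ≤ gVal w01bar m ∧
      ∀ β : ℝ, gVal w01bar m < β → 0 < dimH (piR β '' Uset β {0, 1, m})) ∧
    (∀ u ∈ Sset,
      (muVal u ≤ m →
        Lval m ≤ gVal u m ∧
        ∀ β : ℝ, gVal u m < β → 0 < dimH (piR β '' Uset β {0, 1, m})) ∧
      (m ≤ muVal u →
        Lval m ≤ fVal u m ∧
        ∀ β : ℝ, fVal u m < β → 0 < dimH (piR β '' Uset β {0, 1, m}))) := by
  have hg : ∀ {u : ℕ → Bool}, TernaryBases.Approximable u → TernaryBases.InfOnes u →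
      muVal u ≤ m → Lval m ≤ gVal u m ∧
        ∀ β : ℝ, gVal u m < β → 0 < dimH (piR β '' Uset β {0, 1, m}) := fun hA hu hμ =>
    TernaryBases.Lval_le_and_dimH_pos hA hm.1 fun _ => TernaryBases.lt_of_gVal_lt hu hm hμ
  have hf : ∀ {u : ℕ → Bool}, TernaryBases.Approximable u → TernaryBases.InfOnes u →
      m ≤ muVal u → Lval m ≤ fVal u m ∧
        ∀ β : ℝ, fVal u m < β → 0 < dimH (piR β '' Uset β {0, 1, m}) := fun hA hu hμ =>
    TernaryBases.Lval_le_and_dimH_pos hA hm.1 fun _ => TernaryBases.lt_of_fVal_lt hu hm hμ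
  exact ⟨fun σ hσ => hg (TernaryBases.approximable_comp_M_w10bar hσ)
      (TernaryBases.infOnes_comp_M hσ _),
    fun σ hσ => hf (TernaryBases.approximable_comp_M_w01bar hσ)
      (TernaryBases.infOnes_comp_M hσ _),
    hg TernaryBases.approximable_w01bar TernaryBases.infOnes_w01bar,
    fun u hu => ⟨hg (TernaryBases.approximable_of_mem_Sset hu)
      (TernaryBases.infOnes_of_mem_Sset hu), hf (TernaryBases.approximable_of_mem_Sset hu)
      (TernaryBases.infOnes_of_mem_Sset hu)⟩⟩
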